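/- Let m>0 and let f: ℝ³×ℝ³ → ℂ be a Schwartz function. Define I₊(x) = (2π)^{-3} ∫_{ℝ³}∫_{ℝ³} f(p⃗,q⃗) e^{-i[(ω_m(p⃗)+ω_m(q⃗))x⁰ − (p⃗+q⃗)·x⃗]} (m²/(ω_m(p⃗)ω_m(q⃗))) d³p⃗ d³q⃗. Then: (i) there is a constant C (depending on f, m) such that for every x ∈ ℝ⁴ with x·x ≥ 1, writing λ = sgn(x⁰)(x·x)^{1/2} and u⃗ = x⃗/λ, |I₊(x) − i·sgn(λ)·e^{-2imλ}(m/|λ|)³ f(mu⃗, mu⃗)| ≤ C(1+|x|)^{-4}; and (ii) for every N ≥ 0 there is C_N such that |I₊(x)| ≤ C_N(1+|x|)^{-N} for all x with x·x < 1. -/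

import Mathlib

/-!
Statement 1: asymptotics of the oscillatory integral
`I₊(x) = (2π)^{-3} ∫∫ f(p⃗,q⃗) e^{-i[(ω_m(p⃗)+ω_m(q⃗))x⁰ − (p⃗+q⃗)·x⃗]} m²/(ω_m(p⃗)ω_m(q⃗)) d³p⃗ d³q⃗`.
-/

open MeasureTheory Real Complex
open scoped InnerProductSpace

noncomputable section

abbrev V3 := EuclideanSpace ℝ (Fin 3)

def ωm (m : ℝ) (p : V3) : ℝ := Real.sqrt (m ^ 2 + ‖p‖ ^ 2)

def Iplus (m : ℝ) (f : SchwartzMap (V3 × V3) ℂ) (x0 : ℝ) (xv : V3) : ℂ :=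
  ((((2 * π) ^ 3)⁻¹ : ℝ) : ℂ) *
    ∫ p : V3, ∫ q : V3, f (p, q) *
      Complex.exp (-Complex.I *
        (((ωm m p + ωm m q) * x0 - (⟪p, xv⟫_ℝ + ⟪q, xv⟫_ℝ) : ℝ) : ℂ)) *
      (((m ^ 2 / (ωm m p * ωm m q) : ℝ)) : ℂ)

/-! ### Symbol estimates along a flow -/

section Symbol

variable {X A : Type*} [NormedRing A] [NormedAlgebra ℝ A]

/-- Derivative at time zero of `f` along the curves `t ↦ γ x t`. -/
def flowDeriv (γ : X → ℝ → X) (f : X → A) (x : X) : A := deriv (fun t => f (γ x t)) 0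

/-- `f` is bounded by a multiple of `w`, and each of its first `n` derivatives along `γ` gains a
further factor `ρ`. -/
def IsSymbol (γ : X → ℝ → X) (ρ : X → ℝ) : ℕ → (X → ℝ) → (X → A) → Prop
  | 0, w, f => ∃ C, ∀ x, ‖f x‖ ≤ C * w x
  | n + 1, w, f => (∃ C, ∀ x, ‖f x‖ ≤ C * w x) ∧
      (∀ x, DifferentiableAt ℝ (fun t => f (γ x t)) 0) ∧
      IsSymbol γ ρ n (fun x => w x * ρ x) (flowDeriv γ f)

namespace IsSymbol

variable {γ : X → ℝ → X} {ρ w w₁ w₂ : X → ℝ} {f g : X → A} {n : ℕ}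

lemma exists_bound (h : IsSymbol γ ρ n w f) (hw : ∀ x, 0 ≤ w x) :
    ∃ C, 0 ≤ C ∧ ∀ x, ‖f x‖ ≤ C * w x := by
  have : ∃ C, ∀ x, ‖f x‖ ≤ C * w x := by
    cases n with
    | zero => exact h
    | succ n => exact h.1
  obtain ⟨C, hC⟩ := this
  exact ⟨|C|, abs_nonneg _, fun x =>
    (hC x).trans (mul_le_mul_of_nonneg_right (le_abs_self C) (hw x))⟩

lemma hasDerivAt (h : IsSymbol γ ρ (n + 1) w f) (x : X) :
    HasDerivAt (fun t => f (γ x t)) (flowDeriv γ f x) 0 :=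
  (h.2.1 x).hasDerivAt

lemma flowDeriv (h : IsSymbol γ ρ (n + 1) w f) :
    IsSymbol γ ρ n (fun x => w x * ρ x) (flowDeriv γ f) := h.2.2

lemma of_hasDerivAt {f' : X → A} (hb : ∃ C, ∀ x, ‖f x‖ ≤ C * w x)
    (hd : ∀ x, HasDerivAt (fun t => f (γ x t)) (f' x) 0)
    (hf' : IsSymbol γ ρ n (fun x => w x * ρ x) f') : IsSymbol γ ρ (n + 1) w f := by
  have : _root_.flowDeriv γ f = f' := funext fun x => (hd x).deriv
  exact ⟨hb, fun x => (hd x).differentiableAt, this ▸ hf'⟩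

lemma of_succ (h : IsSymbol γ ρ (n + 1) w f) : IsSymbol γ ρ n w f := by
  induction n generalizing w f with
  | zero => exact h.1
  | succ n ih => exact ⟨h.1, h.2.1, ih h.2.2⟩

lemma exists_bound_mono (h : IsSymbol γ ρ n w₁ f) (hw : ∀ x, 0 ≤ w₁ x)
    {K : ℝ} (hK : ∀ x, w₁ x ≤ K * w₂ x) : ∃ C, ∀ x, ‖f x‖ ≤ C * w₂ x := by
  obtain ⟨C, hC, hb⟩ := h.exists_bound hw
  refine ⟨C * K, fun x => (hb x).trans ?_⟩
  rw [mul_assoc]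
  exact mul_le_mul_of_nonneg_left (hK x) hC

lemma mono (h : IsSymbol γ ρ n w₁ f) (hρ : ∀ x, 0 ≤ ρ x) (hw : ∀ x, 0 ≤ w₁ x)
    {K : ℝ} (hK : ∀ x, w₁ x ≤ K * w₂ x) : IsSymbol γ ρ n w₂ f := by
  induction n generalizing w₁ w₂ f with
  | zero => exact h.exists_bound_mono hw hK
  | succ n ih =>
    refine ⟨h.exists_bound_mono hw hK, h.2.1,
      ih h.2.2 (fun x => mul_nonneg (hw x) (hρ x)) fun x => ?_⟩
    rw [← mul_assoc]
    exact mul_le_mul_of_nonneg_right (hK x) (hρ x)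

lemma congr_weight (h : IsSymbol γ ρ n w₁ f) (hw : ∀ x, w₁ x = w₂ x) : IsSymbol γ ρ n w₂ f :=
  (funext hw : w₁ = w₂) ▸ h

lemma congr (h : IsSymbol γ ρ n w f) (hfg : ∀ x, f x = g x) : IsSymbol γ ρ n w g :=
  (funext hfg : f = g) ▸ h

lemma add (hf : IsSymbol γ ρ n w f) (hg : IsSymbol γ ρ n w g) :
    IsSymbol γ ρ n w (fun x => f x + g x) := by
  have aux : ∀ {w : X → ℝ} {f g : X → A}, (∃ C, ∀ x, ‖f x‖ ≤ C * w x) →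
      (∃ C, ∀ x, ‖g x‖ ≤ C * w x) → ∃ C, ∀ x, ‖f x + g x‖ ≤ C * w x := by
    rintro w f g ⟨C, hC⟩ ⟨D, hD⟩
    exact ⟨C + D, fun x => (norm_add_le _ _).trans (by linarith [hC x, hD x])⟩
  induction n generalizing w f g with
  | zero => exact aux hf hg
  | succ n ih =>
    exact of_hasDerivAt (aux hf.1 hg.1) (fun x => (hf.hasDerivAt x).add (hg.hasDerivAt x))
      (ih hf.2.2 hg.2.2)

lemma exists_bound_mul (hw₁ : ∀ x, 0 ≤ w₁ x) (hw₂ : ∀ x, 0 ≤ w₂ x)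
    (hf : IsSymbol γ ρ n w₁ f) (hg : IsSymbol γ ρ n w₂ g) :
    ∃ C, ∀ x, ‖f x * g x‖ ≤ C * (w₁ x * w₂ x) := by
  obtain ⟨C, hC0, hC⟩ := hf.exists_bound hw₁
  obtain ⟨D, hD0, hD⟩ := hg.exists_bound hw₂
  refine ⟨C * D, fun x => (norm_mul_le _ _).trans ?_⟩
  calc ‖f x‖ * ‖g x‖ ≤ (C * w₁ x) * (D * w₂ x) :=
        mul_le_mul (hC x) (hD x) (norm_nonneg _) (mul_nonneg hC0 (hw₁ x))
    _ = _ := by ring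

lemma mul (hγ : ∀ x, γ x 0 = x) (hρ : ∀ x, 0 ≤ ρ x) (hw₁ : ∀ x, 0 ≤ w₁ x)
    (hw₂ : ∀ x, 0 ≤ w₂ x) (hf : IsSymbol γ ρ n w₁ f) (hg : IsSymbol γ ρ n w₂ g) :
    IsSymbol γ ρ n (fun x => w₁ x * w₂ x) (fun x => f x * g x) := by
  induction n generalizing w₁ w₂ f g with
  | zero => exact exists_bound_mul hw₁ hw₂ hf hg
  | succ n ih =>
    refine of_hasDerivAt (f' := fun x => _root_.flowDeriv γ f x * g x +
      f x * _root_.flowDeriv γ g x) (exists_bound_mul hw₁ hw₂ hf hg) (fun x => ?_) (add ?_ ?_)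
    · have h := (hf.hasDerivAt x).mul (hg.hasDerivAt x)
      simp only [hγ] at h
      exact h
    · exact (ih (fun x => mul_nonneg (hw₁ x) (hρ x)) hw₂ hf.2.2 hg.of_succ).congr_weight
        fun x => by ring
    · exact (ih hw₁ (fun x => mul_nonneg (hw₂ x) (hρ x)) hf.of_succ hg.2.2).congr_weight
        fun x => by ring

lemma of_invariant (hf : ∀ x t, f (γ x t) = f x) (hρ : ∀ x, 0 ≤ ρ x) (hw : ∀ x, 0 ≤ w x)
    (hb : ∃ C, ∀ x, ‖f x‖ ≤ C * w x) : IsSymbol γ ρ n w f := by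
  have zero : ∀ n (w : X → ℝ), (∀ x, 0 ≤ w x) → IsSymbol γ ρ n w (fun _ => (0 : A)) := by
    intro n
    induction n with
    | zero => exact fun w hw => ⟨0, fun x => by simp⟩
    | succ n ih =>
      exact fun w hw => of_hasDerivAt ⟨0, fun x => by simp⟩ (fun x => hasDerivAt_const _ _)
        (ih _ fun x => mul_nonneg (hw x) (hρ x))
  cases n with
  | zero => exact hb
  | succ n =>
    refine of_hasDerivAt hb (fun x => ?_) (zero n _ fun x => mul_nonneg (hw x) (hρ x))
    simpa only [hf] using hasDerivAt_const (0 : ℝ) (f x)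

lemma const_mul (hγ : ∀ x, γ x 0 = x) (hρ : ∀ x, 0 ≤ ρ x) (hw : ∀ x, 0 ≤ w x)
    (hf : IsSymbol γ ρ n w f) (c : A) : IsSymbol γ ρ n w (fun x => c * f x) := by
  have hc : IsSymbol γ ρ n (fun _ => (1 : ℝ)) (fun _ : X => c) :=
    of_invariant (fun _ _ => rfl) hρ (fun _ => zero_le_one) ⟨‖c‖, fun x => by simp⟩
  exact (mul hγ hρ (fun _ => zero_le_one) hw hc hf).congr_weight fun x => one_mul _

lemma sum {ι : Type*} (s : Finset ι) {F : ι → X → A} (hρ : ∀ x, 0 ≤ ρ x) (hw : ∀ x, 0 ≤ w x)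
    (hF : ∀ i ∈ s, IsSymbol γ ρ n w (F i)) : IsSymbol γ ρ n w (fun x => ∑ i ∈ s, F i x) := by
  classical
  induction s using Finset.induction_on with
  | empty =>
    exact of_invariant (fun _ _ => by simp) hρ hw ⟨0, fun x => by simp⟩
  | insert a s ha ih =>
    refine (add (hF a (by simp)) (ih fun i hi => hF i (by simp [hi]))).congr fun x => ?_
    rw [Finset.sum_insert ha]

lemma ofReal {f : X → ℝ} (h : IsSymbol γ ρ n w f) : IsSymbol γ ρ n w (fun x => (f x : ℂ)) := by
  have aux : ∀ {w : X → ℝ} {f : X → ℝ}, (∃ C, ∀ x, ‖f x‖ ≤ C * w x) →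
      ∃ C, ∀ x, ‖(f x : ℂ)‖ ≤ C * w x := by
    rintro w f ⟨C, hC⟩
    exact ⟨C, fun x => by simpa using hC x⟩
  induction n generalizing w f with
  | zero => exact aux h
  | succ n ih =>
    exact of_hasDerivAt (aux h.1) (fun x => (h.hasDerivAt x).ofReal_comp) (ih h.2.2)

end IsSymbol

end Symbol

/-! ### Coordinates on the mass hyperboloid in which the phase is quadratic -/

section Hyperboloid

/-- The energy `√(1 + ‖p‖²)` of a particle of unit mass. -/
def bracket (p : V3) : ℝ := √(1 + ‖p‖ ^ 2)

/-- `√(1 + ‖y‖² / 4)`; if `‖y‖ = 2 sinh (χ / 2)` this is `cosh (χ / 2)`. -/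
def stretch (y : V3) : ℝ := √(1 + ‖y‖ ^ 2 / 4)

/-- The Lorentz boost of the momentum `p` by the velocity `u`. -/
def boost (u p : V3) : V3 := p + (⟪p, u⟫_ℝ / (1 + bracket u) + bracket p) • u

/-- Coordinates on the unit hyperboloid centred at `u`, in which the Minkowski product with `u`
is `1 + ‖y‖² / 2`. -/
def chart (u y : V3) : V3 := boost u (stretch y • y)

lemma bracket_sq (p : V3) : bracket p ^ 2 = 1 + ‖p‖ ^ 2 := Real.sq_sqrt (by positivity)

lemma one_le_bracket (p : V3) : 1 ≤ bracket p :=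
  Real.one_le_sqrt.2 (by nlinarith [sq_nonneg ‖p‖])

lemma bracket_pos (p : V3) : 0 < bracket p := zero_lt_one.trans_le (one_le_bracket p)

lemma norm_le_bracket (p : V3) : ‖p‖ ≤ bracket p := Real.le_sqrt_of_sq_le (by linarith)

lemma bracket_le_one_add_norm (p : V3) : bracket p ≤ 1 + ‖p‖ :=
  Real.sqrt_le_iff.2 ⟨by positivity, by nlinarith [norm_nonneg p]⟩

lemma continuous_bracket : Continuous bracket := by unfold bracket; fun_prop

lemma stretch_sq (y : V3) : stretch y ^ 2 = 1 + ‖y‖ ^ 2 / 4 := Real.sq_sqrt (by positivity)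

lemma one_le_stretch (y : V3) : 1 ≤ stretch y :=
  Real.one_le_sqrt.2 (by nlinarith [sq_nonneg ‖y‖])

lemma stretch_pos (y : V3) : 0 < stretch y := zero_lt_one.trans_le (one_le_stretch y)

lemma continuous_stretch : Continuous stretch := by unfold stretch; fun_prop

lemma bracket_eq_of_sq {p : V3} {c : ℝ} (hc : 0 ≤ c) (h : c ^ 2 = 1 + ‖p‖ ^ 2) :
    bracket p = c := by
  rw [bracket, ← h, Real.sqrt_sq hc]

lemma bracket_stretch_smul (y : V3) : bracket (stretch y • y) = 1 + ‖y‖ ^ 2 / 2 := by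
  refine bracket_eq_of_sq (by positivity) ?_
  rw [norm_smul, mul_pow, Real.norm_eq_abs, sq_abs, stretch_sq]
  ring

lemma abs_inner_le_bracket_mul (p u : V3) : |⟪p, u⟫_ℝ| ≤ bracket u * bracket p :=
  (abs_real_inner_le_norm p u).trans (by
    rw [mul_comm]
    exact mul_le_mul (norm_le_bracket u) (norm_le_bracket p) (norm_nonneg _) (bracket_pos u).le)

lemma inner_boost (u p : V3) :
    ⟪boost u p, u⟫_ℝ = bracket u * ⟪p, u⟫_ℝ + bracket p * (bracket u ^ 2 - 1) := by
  have h : ‖u‖ ^ 2 = bracket u ^ 2 - 1 := by rw [bracket_sq]; ring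
  have h0 : 1 + bracket u ≠ 0 := by linarith [bracket_pos u]
  rw [boost, inner_add_left, real_inner_smul_left, real_inner_self_eq_norm_sq, h]
  field_simp
  ring

lemma bracket_boost (u p : V3) : bracket (boost u p) = bracket u * bracket p + ⟪p, u⟫_ℝ := by
  have h : ‖u‖ ^ 2 = bracket u ^ 2 - 1 := by rw [bracket_sq]; ring
  have hp : ‖p‖ ^ 2 = bracket p ^ 2 - 1 := by rw [bracket_sq]; ring
  have h0 : 1 + bracket u ≠ 0 := by linarith [bracket_pos u]
  refine bracket_eq_of_sq ?_ ?_
  · linarith [neg_abs_le ⟪p, u⟫_ℝ, abs_inner_le_bracket_mul p u]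
  · rw [boost, norm_add_sq_real, real_inner_smul_right, norm_smul, mul_pow, Real.norm_eq_abs,
      sq_abs, h, hp]
    field_simp
    ring

lemma bracket_mul_bracket_boost_sub (u p : V3) :
    bracket u * bracket (boost u p) - ⟪boost u p, u⟫_ℝ = bracket p := by
  rw [bracket_boost, inner_boost]
  ring

lemma bracket_neg (u : V3) : bracket (-u) = bracket u := by simp [bracket]

lemma boost_neg_boost (u p : V3) : boost (-u) (boost u p) = p := by
  have h0 : 1 + bracket u ≠ 0 := by linarith [bracket_pos u]
  have key : -⟪boost u p, u⟫_ℝ / (1 + bracket u) + bracket (boost u p) =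
      ⟪p, u⟫_ℝ / (1 + bracket u) + bracket p := by
    rw [bracket_boost, inner_boost]
    field_simp
    ring
  rw [boost, bracket_neg, inner_neg_right, key, boost, smul_neg, add_neg_cancel_right]

lemma bijective_boost (u : V3) : Function.Bijective (boost u) :=
  Function.bijective_iff_has_inverse.2
    ⟨boost (-u), boost_neg_boost u, fun p => by simpa using boost_neg_boost (-u) p⟩

lemma bracket_le_two_mul_boost (u p : V3) : bracket p ≤ 2 * bracket u * bracket (boost u p) := by
  have h := bracket_mul_bracket_boost_sub u p
  linarith [neg_abs_le ⟪boost u p, u⟫_ℝ, abs_inner_le_bracket_mul (boost u p) u]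

lemma bracket_le_two_mul_mul_boost (u p : V3) :
    bracket u ≤ 2 * bracket p * bracket (boost u p) := by
  have h := bracket_le_two_mul_boost u p
  set q := boost u p
  have h1 := bracket_mul_bracket_boost_sub u p
  have h2 : ⟪q, u⟫_ℝ ≤ ‖q‖ * bracket u := (real_inner_le_norm q u).trans
    (mul_le_mul_of_nonneg_left (norm_le_bracket u) (norm_nonneg q))
  have h3 : bracket u * (bracket q - ‖q‖) ≤ bracket p := by linarith
  have h4 : (bracket q - ‖q‖) * (bracket q + ‖q‖) = 1 := by linear_combination bracket_sq q
  calc bracket u = bracket u * (bracket q - ‖q‖) * (bracket q + ‖q‖) := by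
        rw [mul_assoc, h4, mul_one]
    _ ≤ bracket p * (bracket q + ‖q‖) :=
        mul_le_mul_of_nonneg_right h3 (by linarith [norm_nonneg q, bracket_pos q])
    _ ≤ bracket p * (bracket q + bracket q) :=
        mul_le_mul_of_nonneg_left (by linarith [norm_le_bracket q]) (bracket_pos p).le
    _ = _ := by ring

lemma continuous_boost (u : V3) : Continuous (boost u) := by
  have := continuous_bracket
  unfold boost
  fun_prop

lemma continuous_chart (u : V3) : Continuous (chart u) := by
  have := continuous_stretch
  exact (continuous_boost u).comp (by fun_prop)

lemma bijective_stretch_smul : Function.Bijective (fun y : V3 => stretch y • y) := by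
  have h0 : ∀ p : V3, 0 < (1 + bracket p) / 2 := fun p => by linarith [bracket_pos p]
  refine Function.bijective_iff_has_inverse.2
    ⟨fun p => (√((1 + bracket p) / 2))⁻¹ • p, fun y => ?_, fun p => ?_⟩
  · simp only [bracket_stretch_smul]
    have : (1 + (1 + ‖y‖ ^ 2 / 2)) / 2 = 1 + ‖y‖ ^ 2 / 4 := by ring
    rw [this, smul_smul, ← stretch, inv_mul_cancel₀ (stretch_pos y).ne', one_smul]
  · have hs : stretch ((√((1 + bracket p) / 2))⁻¹ • p) = √((1 + bracket p) / 2) := by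
      rw [stretch]
      congr 1
      rw [norm_smul, mul_pow, norm_inv, inv_pow, Real.norm_eq_abs, sq_abs,
        Real.sq_sqrt (h0 p).le]
      have : ‖p‖ ^ 2 = (bracket p - 1) * (bracket p + 1) := by linear_combination -bracket_sq p
      rw [this]
      have := (h0 p).ne'
      have : 1 + bracket p ≠ 0 := by linarith [bracket_pos p]
      field_simp
      ring
    simp only [hs]
    rw [smul_smul, mul_inv_cancel₀ (Real.sqrt_pos.2 (h0 p)).ne', one_smul]

lemma det_smul_id_add_rankOne (c : ℝ) (hc : c ≠ 0) (a b : V3) :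
    (c • ContinuousLinearMap.id ℝ V3 + (innerSL ℝ a).smulRight b).det =
      c ^ 3 * (1 + ⟪a, b⟫_ℝ / c) := by
  have h : ((c • ContinuousLinearMap.id ℝ V3 + (innerSL ℝ a).smulRight b : V3 →L[ℝ] V3) :
      V3 →ₗ[ℝ] V3) = c • LinearMap.transvection ((innerSL ℝ a : V3 →L[ℝ] ℝ) : V3 →ₗ[ℝ] ℝ)
        (c⁻¹ • b) := by
    ext v : 1
    simp [LinearMap.transvection.apply, smul_smul, hc, mul_comm]
  rw [ContinuousLinearMap.det, h, LinearMap.det_smul, LinearMap.transvection.det]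
  simp [div_eq_inv_mul]

lemma hasFDerivAt_stretch (y : V3) :
    HasFDerivAt stretch ((4 * stretch y)⁻¹ • innerSL ℝ y) y := by
  have h : HasFDerivAt (fun y : V3 => 1 + ‖y‖ ^ 2 / 4) ((1 / 4 : ℝ) • (2 • innerSL ℝ y)) y := by
    have := ((hasStrictFDerivAt_norm_sq y).hasFDerivAt.const_mul (1 / 4 : ℝ)).const_add 1
    refine this.congr_of_eventuallyEq (Filter.Eventually.of_forall fun z => ?_)
    simp only
    ring
  have := h.sqrt (by positivity)
  refine this.congr_fderiv ?_
  ext v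
  have := (stretch_pos y).ne'
  simp only [_root_.smul_apply, smul_eq_mul, nsmul_eq_mul]
  rw [← stretch]
  push_cast
  field_simp

lemma hasFDerivAt_bracket (p : V3) : HasFDerivAt bracket ((bracket p)⁻¹ • innerSL ℝ p) p := by
  have := ((hasStrictFDerivAt_norm_sq p).hasFDerivAt.const_add 1).sqrt
    (by positivity : 1 + ‖p‖ ^ 2 ≠ 0)
  refine this.congr_fderiv ?_
  ext v
  have := (bracket_pos p).ne'
  simp only [_root_.smul_apply, smul_eq_mul, nsmul_eq_mul]
  rw [← bracket]
  push_cast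
  field_simp

lemma hasFDerivAt_stretch_smul (y : V3) :
    HasFDerivAt (fun y : V3 => stretch y • y) (stretch y • ContinuousLinearMap.id ℝ V3 +
      (innerSL ℝ ((4 * stretch y)⁻¹ • y)).smulRight y) y := by
  refine ((hasFDerivAt_stretch y).smul (hasFDerivAt_id y)).congr_fderiv ?_
  simp

lemma hasFDerivAt_boost (u p : V3) :
    HasFDerivAt (boost u) ((1 : ℝ) • ContinuousLinearMap.id ℝ V3 +
      (innerSL ℝ ((1 + bracket u)⁻¹ • u + (bracket p)⁻¹ • p)).smulRight u) p := by
  have h1 : HasFDerivAt (fun p : V3 => ⟪p, u⟫_ℝ / (1 + bracket u))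
      ((1 + bracket u)⁻¹ • innerSL ℝ u) p := by
    refine (((innerSL ℝ u).hasFDerivAt (x := p)).const_mul (1 + bracket u)⁻¹).congr_of_eventuallyEq
      (Filter.Eventually.of_forall fun z => ?_)
    simp [real_inner_comm, div_eq_inv_mul]
  refine ((hasFDerivAt_id p).add ((h1.add (hasFDerivAt_bracket p)).smul_const u)).congr_fderiv ?_
  simp

lemma integral_comp_boost {F : Type*} [NormedAddCommGroup F] [NormedSpace ℝ F] (u : V3)
    (G : V3 → F) :
    ∫ p, (bracket (boost u p) / bracket p) • G (boost u p) = ∫ p, G p := by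
  have h := integral_image_eq_integral_abs_det_fderiv_smul volume MeasurableSet.univ
    (fun p _ => (hasFDerivAt_boost u p).hasFDerivWithinAt)
    (bijective_boost u).injective.injOn G
  rw [Set.image_univ, (bijective_boost u).surjective.range_eq] at h
  simp only [Measure.restrict_univ] at h
  rw [h]
  refine integral_congr_ae (Filter.Eventually.of_forall fun p => ?_)
  simp only
  congr 1
  have hu : ‖u‖ ^ 2 = bracket u ^ 2 - 1 := by rw [bracket_sq]; ring
  have h0 : 1 + bracket u ≠ 0 := by linarith [bracket_pos u]
  have h1 := (bracket_pos p).ne'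
  rw [det_smul_id_add_rankOne _ one_ne_zero, inner_add_left, real_inner_smul_left,
    real_inner_smul_left, real_inner_self_eq_norm_sq, hu]
  have : (1 : ℝ) ^ 3 * (1 + ((1 + bracket u)⁻¹ * (bracket u ^ 2 - 1) +
      (bracket p)⁻¹ * ⟪p, u⟫_ℝ) / 1) = bracket (boost u p) / bracket p := by
    rw [bracket_boost]
    field_simp
    ring
  rw [this, abs_of_pos (div_pos (bracket_pos _) (bracket_pos _))]

lemma integral_comp_stretch_smul {F : Type*} [NormedAddCommGroup F] [NormedSpace ℝ F]
    (G : V3 → F) :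
    ∫ y, (stretch y * bracket (stretch y • y)) • G (stretch y • y) = ∫ p, G p := by
  have h := integral_image_eq_integral_abs_det_fderiv_smul volume MeasurableSet.univ
    (fun y _ => (hasFDerivAt_stretch_smul y).hasFDerivWithinAt)
    bijective_stretch_smul.injective.injOn G
  rw [Set.image_univ, bijective_stretch_smul.surjective.range_eq] at h
  simp only [Measure.restrict_univ] at h
  rw [h]
  refine integral_congr_ae (Filter.Eventually.of_forall fun y => ?_)
  simp only
  congr 1
  have h1 := (stretch_pos y).ne'
  rw [det_smul_id_add_rankOne _ h1, real_inner_smul_left, real_inner_self_eq_norm_sq]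
  have : stretch y ^ 3 * (1 + (4 * stretch y)⁻¹ * ‖y‖ ^ 2 / stretch y) =
      stretch y * bracket (stretch y • y) := by
    rw [bracket_stretch_smul]
    have := stretch_sq y
    field_simp
    rw [this]
    ring
  rw [this, abs_of_pos (mul_pos (stretch_pos _) (bracket_pos _))]

lemma integral_comp_chart {F : Type*} [NormedAddCommGroup F] [NormedSpace ℝ F] (u : V3)
    (G : V3 → F) :
    ∫ y, (stretch y * bracket (chart u y)) • G (chart u y) = ∫ p, G p := by
  rw [← integral_comp_boost u G, ← integral_comp_stretch_smul
    fun p => (bracket (boost u p) / bracket p) • G (boost u p)]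
  refine integral_congr_ae (Filter.Eventually.of_forall fun y => ?_)
  simp only [smul_smul, chart]
  congr 1
  have := (bracket_pos (stretch y • y)).ne'
  field_simp

lemma integrable_bracket_pow_inv : Integrable (fun p : V3 => (bracket p ^ 4)⁻¹) := by
  have h := integrable_rpow_neg_one_add_norm_sq (E := V3) (μ := volume) (r := 4) (by simp; norm_num)
  refine h.congr (Filter.Eventually.of_forall fun p => ?_)
  simp only
  rw [show (bracket p) ^ 4 = (1 + ‖p‖ ^ 2) ^ 2 by rw [← bracket_sq]; ring,
    show (-4 / 2 : ℝ) = ((-2 : ℤ) : ℝ) by norm_num, Real.rpow_intCast, zpow_neg]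
  norm_cast

lemma integrable_stretch_mul_bracket_chart (u : V3) :
    Integrable (fun y : V3 => stretch y * (bracket (chart u y) ^ 3)⁻¹) ∧
      ∫ y : V3, stretch y * (bracket (chart u y) ^ 3)⁻¹ = ∫ p : V3, (bracket p ^ 4)⁻¹ := by
  have h := integral_comp_chart u fun p => (bracket p ^ 4)⁻¹
  have h' : ∀ y, (stretch y * bracket (chart u y)) • (bracket (chart u y) ^ 4)⁻¹ =
      stretch y * (bracket (chart u y) ^ 3)⁻¹ := fun y => by
    have := (bracket_pos (chart u y)).ne'
    rw [smul_eq_mul]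
    field_simp
  simp only [h'] at h
  refine ⟨Integrable.of_integral_ne_zero ?_, h⟩
  rw [h]
  refine (integral_pos_of_integrable_nonneg_nonzero (x := 0) ?_ integrable_bracket_pow_inv
    (fun p => ?_) ?_).ne'
  · exact (continuous_bracket.pow 4).inv₀ fun p => (pow_pos (bracket_pos p) 4).ne'
  · exact (inv_pos.2 (pow_pos (bracket_pos p) 4)).le
  · exact (inv_pos.2 (pow_pos (bracket_pos 0) 4)).ne'

end Hyperboloid

/-! ### Radial stationary phase -/

section Radial

lemma hasDerivAt_cexp_quadratic (μ r : ℝ) :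
    HasDerivAt (fun r : ℝ => cexp (-(I * μ * r ^ 2 / 2)))
      (-(I * μ * r) * cexp (-(I * μ * r ^ 2 / 2))) r := by
  have h : HasDerivAt (fun r : ℝ => -(I * μ * (r : ℂ) ^ 2 / 2)) (-(I * μ * r)) r := by
    have h1 : HasDerivAt (fun r : ℝ => (r : ℂ)) 1 r := Complex.ofRealCLM.hasDerivAt
    refine ((((h1.pow 2).const_mul (I * μ)).div_const 2).neg).congr_deriv ?_
    simp
    ring
  simpa [mul_comm] using h.cexp

lemma norm_cexp_quadratic (μ r : ℝ) : ‖cexp (-(I * μ * r ^ 2 / 2))‖ = 1 := by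
  rw [show -(I * μ * (r : ℂ) ^ 2 / 2) = ((-(μ * r ^ 2 / 2) : ℝ) : ℂ) * I by push_cast; ring]
  exact Complex.norm_exp_ofReal_mul_I _

/-- Fourfold integration by parts for a radial integral with quadratic phase in dimension six. -/
lemma integral_radial_quadratic_phase {F₀ F₁ F₂ F₃ F₄ : ℝ → ℂ}
    (h₀ : ∀ r, HasDerivAt F₀ (F₁ r) r) (h₁ : ∀ r, HasDerivAt F₁ (F₂ r) r)
    (h₂ : ∀ r, HasDerivAt F₂ (F₃ r) r) (h₃ : ∀ r, HasDerivAt F₃ (F₄ r) r)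
    (hF₁ : F₁ 0 = 0) {μ : ℝ} (hμ : μ ≠ 0) {K : ℝ}
    (hK₀ : ∀ r, 1 ≤ r → ‖F₀ r‖ ≤ K / r ^ 7) (hK₁ : ∀ r, 1 ≤ r → ‖F₁ r‖ ≤ K / r ^ 7)
    (hK₂ : ∀ r, 1 ≤ r → ‖F₂ r‖ ≤ K / r ^ 7) (hK₃ : ∀ r, 1 ≤ r → ‖F₃ r‖ ≤ K / r ^ 7)
    (hInt : IntegrableOn (fun r : ℝ => 15 * (F₂ r / r - F₁ r / r ^ 2) + 10 * F₃ r + r * F₄ r)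
      (Set.Ioi 0)) :
    ∫ r in Set.Ioi (0 : ℝ), (r : ℂ) ^ 5 * F₀ r * cexp (-(I * μ * r ^ 2 / 2)) =
      8 * F₀ 0 / (I * μ) ^ 3 + (I * μ) ^ (-4 : ℤ) * (24 * F₂ 0 + ∫ r in Set.Ioi (0 : ℝ),
        (15 * (F₂ r / r - F₁ r / r ^ 2) + 10 * F₃ r + r * F₄ r) *
          cexp (-(I * μ * r ^ 2 / 2))) := by
  have hc : I * (μ : ℂ) ≠ 0 := mul_ne_zero I_ne_zero (by exact_mod_cast hμ)
  set c : ℂ := I * μ with hcdef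
  set E : ℝ → ℂ := fun r => cexp (-(c * r ^ 2 / 2)) with hE
  have hEd : ∀ r : ℝ, HasDerivAt E (-(c * r) * E r) r := hasDerivAt_cexp_quadratic μ
  have hEn : ∀ r : ℝ, ‖E r‖ = 1 := norm_cexp_quadratic μ
  have hEc : Continuous E := by rw [hE]; fun_prop
  have hF₀c : Continuous F₀ := continuous_iff_continuousAt.2 fun r => (h₀ r).continuousAt
  have hF₁c : Continuous F₁ := continuous_iff_continuousAt.2 fun r => (h₁ r).continuousAt
  have hF₂c : Continuous F₂ := continuous_iff_continuousAt.2 fun r => (h₂ r).continuousAt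
  have hF₃c : Continuous F₃ := continuous_iff_continuousAt.2 fun r => (h₃ r).continuousAt
  have hK : 0 ≤ K := by simpa using (norm_nonneg _).trans (hK₀ 1 le_rfl)
  set R : ℝ → ℂ := fun r => 15 * (F₂ r / r - F₁ r / r ^ 2) + 10 * F₃ r + r * F₄ r with hR
  set D : ℝ → ℂ := dslope F₁ 0 with hD
  have hD0 : D 0 = F₂ 0 := by rw [hD, dslope_same]; exact (h₁ 0).deriv
  have hDr : ∀ r : ℝ, r ≠ 0 → D r = F₁ r / r := fun r hr => by
    rw [hD, dslope_of_ne _ hr, slope, hF₁]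
    simp [div_eq_inv_mul]
  set B : ℝ → ℂ := fun r => (r : ℂ) ^ 4 * F₀ r / c + (4 * (r : ℂ) ^ 2 * F₀ r + r ^ 3 * F₁ r) / c ^ 2
    + (8 * F₀ r + 7 * r * F₁ r + r ^ 2 * F₂ r) / c ^ 3
    + (15 * D r + 9 * F₂ r + r * F₃ r) / c ^ 4 with hB
  have hofReal : ∀ r : ℝ, HasDerivAt (fun r : ℝ => (r : ℂ)) 1 r :=
    fun r => Complex.ofRealCLM.hasDerivAt
  have hderiv : ∀ r ∈ Set.Ioi (0 : ℝ), HasDerivAt (fun r => -(E r * B r))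
      ((r : ℂ) ^ 5 * F₀ r * E r - c ^ (-4 : ℤ) * (R r * E r)) r := by
    intro r hr
    have hr0 : (r : ℂ) ≠ 0 := by exact_mod_cast (ne_of_gt hr)
    have hDd : HasDerivAt D (F₂ r / r - F₁ r / r ^ 2) r := by
      have h := (h₁ r).div (hofReal r) hr0
      refine (h.congr_of_eventuallyEq ?_).congr_deriv ?_
      · filter_upwards [eventually_ne_nhds (ne_of_gt hr)] with s hs
        exact hDr s hs
      · field_simp
    have t0 := (((hofReal r).pow 4).mul (h₀ r)).div_const c
    have t1 := (((((hofReal r).pow 2).const_mul 4).mul (h₀ r)).add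
      (((hofReal r).pow 3).mul (h₁ r))).div_const (c ^ 2)
    have t2 := ((((h₀ r).const_mul 8).add (((hofReal r).const_mul 7).mul (h₁ r))).add
      (((hofReal r).pow 2).mul (h₂ r))).div_const (c ^ 3)
    have t3 := (((hDd.const_mul 15).add ((h₂ r).const_mul 9)).add
      ((hofReal r).mul (h₃ r))).div_const (c ^ 4)
    refine (((hEd r).mul (((t0.add t1).add t2).add t3)).neg).congr_deriv ?_
    simp only [hR, Pi.add_apply, Pi.mul_apply, Pi.pow_apply, hDr r (ne_of_gt hr), zpow_neg]
    norm_cast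
    push_cast
    field_simp
    ring
  have hcont : ContinuousWithinAt (fun r => -(E r * B r)) (Set.Ici 0) 0 := by
    have : ContinuousAt D 0 := continuousAt_dslope_same.2 (h₁ 0).differentiableAt
    refine ContinuousAt.continuousWithinAt ?_
    fun_prop
  have hInt₀ : IntegrableOn (fun r : ℝ => (r : ℂ) ^ 5 * F₀ r * E r) (Set.Ioi 0) := by
    have hcts : Continuous fun r : ℝ => (r : ℂ) ^ 5 * F₀ r * E r := by fun_prop
    rw [← Set.Ioc_union_Ioi_eq_Ioi (zero_le_one' ℝ)]
    refine IntegrableOn.union (hcts.integrableOn_Ioc) ?_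
    have hi : IntegrableOn (fun r : ℝ => K * r ^ (-2 : ℝ)) (Set.Ioi 1) :=
      (integrableOn_Ioi_rpow_of_lt (by norm_num) one_pos).const_mul K
    refine Integrable.mono' hi hcts.aestronglyMeasurable ?_
    filter_upwards [ae_restrict_mem measurableSet_Ioi] with r hr
    have hr1 : (1 : ℝ) ≤ r := le_of_lt hr
    have hr0 : 0 < r := zero_lt_one.trans_le hr1
    rw [norm_mul, hEn, mul_one, norm_mul, norm_pow, Complex.norm_real, Real.norm_of_nonneg hr0.le]
    calc r ^ 5 * ‖F₀ r‖ ≤ r ^ 5 * (K / r ^ 7) :=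
          mul_le_mul_of_nonneg_left (hK₀ r hr1) (by positivity)
      _ = K * r ^ (-2 : ℝ) := by
          rw [show (-2 : ℝ) = ((-2 : ℤ) : ℝ) by norm_num, Real.rpow_intCast, zpow_neg]
          norm_cast
          field_simp
  have hIntR : IntegrableOn (fun r : ℝ => R r * E r) (Set.Ioi 0) := by
    refine Integrable.mono hInt (hInt.aestronglyMeasurable.mul hEc.aestronglyMeasurable) ?_
    exact Filter.Eventually.of_forall fun r => by simp [hEn]
  have hlim : Filter.Tendsto (fun r => -(E r * B r)) Filter.atTop (nhds 0) := by
    set M : ℝ := K / ‖c‖ + 5 * K / ‖c‖ ^ 2 + 16 * K / ‖c‖ ^ 3 + 25 * K / ‖c‖ ^ 4 with hM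
    have hM0 : Filter.Tendsto (fun r : ℝ => M * r⁻¹) Filter.atTop (nhds 0) := by
      simpa using tendsto_inv_atTop_zero.const_mul M
    refine squeeze_zero_norm' ?_ hM0
    filter_upwards [Filter.eventually_ge_atTop (1 : ℝ)] with r hr
    have hr0 : 0 < r := zero_lt_one.trans_le hr
    have hpow : ∀ {j : ℕ} (_ : j ≤ 6) {z : ℂ}, ‖z‖ ≤ K / r ^ 7 → r ^ j * ‖z‖ ≤ K * r⁻¹ := by
      intro j hj z hz
      calc r ^ j * ‖z‖ ≤ r ^ 6 * (K / r ^ 7) :=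
            mul_le_mul (pow_le_pow_right₀ hr hj) hz (norm_nonneg _) (by positivity)
        _ = K * r⁻¹ := by field_simp
    have n0 := hK₀ r hr
    have n1 := hK₁ r hr
    have n2 := hK₂ r hr
    have n3 := hK₃ r hr
    have hcr : ‖(r : ℂ)‖ = r := by rw [Complex.norm_real, Real.norm_of_nonneg hr0.le]
    have hD' : ‖D r‖ ≤ ‖F₁ r‖ := by
      rw [hDr r hr0.ne', norm_div, hcr]
      exact div_le_self (norm_nonneg _) hr
    rw [norm_neg, norm_mul, hEn, one_mul]
    have e1 : ‖(r : ℂ) ^ 4 * F₀ r / c‖ ≤ K / ‖c‖ * r⁻¹ := by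
      rw [norm_div, norm_mul, norm_pow, hcr, div_mul_eq_mul_div]
      exact div_le_div_of_nonneg_right (hpow (j := 4) (by norm_num) n0) (norm_nonneg _)
    have e2 : ‖(4 * (r : ℂ) ^ 2 * F₀ r + r ^ 3 * F₁ r) / c ^ 2‖ ≤ 5 * K / ‖c‖ ^ 2 * r⁻¹ := by
      rw [norm_div, norm_pow, div_mul_eq_mul_div]
      gcongr
      refine (norm_add_le _ _).trans ?_
      simp only [norm_mul, norm_pow, hcr, RCLike.norm_ofNat]
      have a := hpow (j := 2) (by norm_num) n0
      have b := hpow (j := 3) (by norm_num) n1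
      linarith
    have e3 : ‖(8 * F₀ r + 7 * r * F₁ r + r ^ 2 * F₂ r) / c ^ 3‖ ≤ 16 * K / ‖c‖ ^ 3 * r⁻¹ := by
      rw [norm_div, norm_pow, div_mul_eq_mul_div]
      gcongr
      refine (norm_add₃_le).trans ?_
      simp only [norm_mul, norm_pow, hcr, RCLike.norm_ofNat]
      have a := hpow (j := 0) (by norm_num) n0
      have b := hpow (j := 1) (by norm_num) n1
      have d := hpow (j := 2) (by norm_num) n2
      linarith
    have e4 : ‖(15 * D r + 9 * F₂ r + r * F₃ r) / c ^ 4‖ ≤ 25 * K / ‖c‖ ^ 4 * r⁻¹ := by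
      rw [norm_div, norm_pow, div_mul_eq_mul_div]
      gcongr
      refine (norm_add₃_le).trans ?_
      simp only [norm_mul, hcr, RCLike.norm_ofNat]
      have a := hpow (j := 0) (by norm_num) (hD'.trans n1)
      have b := hpow (j := 0) (by norm_num) n2
      have d := hpow (j := 1) (by norm_num) n3
      linarith
    calc ‖B r‖ ≤ _ := (norm_add_le _ _).trans (add_le_add (norm_add₃_le.trans
          (add_le_add (add_le_add e1 e2) e3)) e4)
      _ = M * r⁻¹ := by rw [hM]; ring
  have hFTC := integral_Ioi_of_hasDerivAt_of_tendsto hcont hderiv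
    (hInt₀.sub (hIntR.const_mul _)) hlim
  rw [integral_sub hInt₀ (hIntR.const_mul _), integral_const_mul] at hFTC
  have hval : E 0 * B 0 = 8 * F₀ 0 / c ^ 3 + c ^ (-4 : ℤ) * (24 * F₂ 0) := by
    simp only [hE, hB, hD0]
    rw [zpow_neg]
    norm_cast
    simp
    ring
  rw [hval] at hFTC
  linear_combination hFTC

end Radial

/-! ### Symbol estimates along rays in the chart -/

section Ray

/-- A velocity, a direction in `ℝ³ × ℝ³` with components of norm at most one, and a radius. -/
structure RayPoint where
  /-- the velocity at which the chart is centred -/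
  u : V3
  /-- the two components of the direction -/
  d : Fin 2 → V3
  /-- the radius -/
  r : ℝ
  norm_d_le : ∀ i, ‖d i‖ ≤ 1

namespace RayPoint

/-- Radial translation. -/
def flow (x : RayPoint) (t : ℝ) : RayPoint := { x with r := x.r + t }

/-- The gain of one radial derivative. -/
def gain (x : RayPoint) : ℝ := (1 + |x.r|)⁻¹

/-- The stretch factor of the `i`-th component. -/
def s (x : RayPoint) (i : Fin 2) : ℝ := stretch (x.r • x.d i)

/-- The radial derivative of the rapidity of the `i`-th component. -/
def δ (x : RayPoint) (i : Fin 2) : ℝ := ‖x.d i‖ / x.s i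

/-- The hyperbolic tangent of half the rapidity of the `i`-th component. -/
def κ (x : RayPoint) (i : Fin 2) : ℝ := ‖x.d i‖ * x.r / (2 * x.s i)

/-- The image of the `i`-th direction under the linear part of the boost. -/
def v (x : RayPoint) (i : Fin 2) : V3 := x.d i + (⟪x.d i, x.u⟫_ℝ / (1 + bracket x.u)) • x.u

/-- The `i`-th momentum. -/
def P (x : RayPoint) (i : Fin 2) : V3 := chart x.u (x.r • x.d i)

/-- The radial derivative of the `i`-th momentum. -/
def D (x : RayPoint) (i : Fin 2) : V3 :=
  ((1 + ‖x.d i‖ ^ 2 * x.r ^ 2 / 2) / x.s i) • x.v i + (‖x.d i‖ ^ 2 * x.r) • x.u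

/-- The product of the two energies. -/
def W (x : RayPoint) : ℝ := bracket (x.P 0) * bracket (x.P 1)

variable (x : RayPoint) (i : Fin 2)

lemma flow_zero : x.flow 0 = x := by simp [flow]

lemma gain_pos : 0 < x.gain := inv_pos.2 (by positivity)

lemma one_le_s : 1 ≤ x.s i := one_le_stretch _

lemma s_pos : 0 < x.s i := stretch_pos _

lemma s_sq : x.s i ^ 2 = 1 + ‖x.d i‖ ^ 2 * x.r ^ 2 / 4 := by
  rw [s, stretch_sq, norm_smul, mul_pow, Real.norm_eq_abs, sq_abs]
  ring

lemma one_le_W : 1 ≤ x.W := one_le_mul_of_one_le_of_one_le (one_le_bracket _) (one_le_bracket _)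

lemma W_pos : 0 < x.W := zero_lt_one.trans_le x.one_le_W

lemma bracket_P_le_W : bracket (x.P i) ≤ x.W := by
  have h0 := one_le_bracket (x.P 0)
  have h1 := one_le_bracket (x.P 1)
  fin_cases i <;> simp only [W, Fin.zero_eta, Fin.mk_one] <;> nlinarith

lemma P_eq : x.P i = (x.s i * x.r) • x.v i + (1 + ‖x.d i‖ ^ 2 * x.r ^ 2 / 2) • x.u := by
  have h : ‖x.r • x.d i‖ ^ 2 = ‖x.d i‖ ^ 2 * x.r ^ 2 := by
    rw [norm_smul, mul_pow, Real.norm_eq_abs, sq_abs]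
    ring
  rw [P, chart, boost, bracket_stretch_smul, h, v]
  rw [show stretch (x.r • x.d i) = x.s i from rfl]
  simp only [inner_smul_left, conj_trivial]
  module

lemma bracket_P : bracket (x.P i) =
    bracket x.u * (1 + ‖x.d i‖ ^ 2 * x.r ^ 2 / 2) + x.s i * x.r * ⟪x.d i, x.u⟫_ℝ := by
  have h : ‖x.r • x.d i‖ ^ 2 = ‖x.d i‖ ^ 2 * x.r ^ 2 := by
    rw [norm_smul, mul_pow, Real.norm_eq_abs, sq_abs]
    ring
  rw [P, chart, bracket_boost, bracket_stretch_smul, h]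
  rw [show stretch (x.r • x.d i) = x.s i from rfl]
  simp only [inner_smul_left, conj_trivial]
  ring

lemma hasDerivAt_s : HasDerivAt (fun t => (x.flow t).s i) (1 / 2 * (x.δ i * x.κ i) * x.s i) 0 := by
  have e : ∀ t, (x.flow t).s i = √(1 + ‖x.d i‖ ^ 2 * (x.r + t) ^ 2 / 4) := fun t => by
    rw [show x.r + t = (x.flow t).r from rfl, show x.d i = (x.flow t).d i from rfl,
      ← (x.flow t).s_sq, Real.sqrt_sq ((x.flow t).s_pos i).le]
  simp only [e]
  have h : HasDerivAt (fun t : ℝ => 1 + ‖x.d i‖ ^ 2 * (x.r + t) ^ 2 / 4)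
      (‖x.d i‖ ^ 2 * x.r / 2) 0 := by
    refine (((((hasDerivAt_id (0 : ℝ)).const_add x.r).pow 2).const_mul
      (‖x.d i‖ ^ 2)).div_const 4 |>.const_add 1).congr_deriv ?_
    simp
    ring
  refine (h.sqrt (by positivity)).congr_deriv ?_
  rw [← e 0, flow_zero, δ, κ]
  have := (x.s_pos i).ne'
  field_simp

lemma hasDerivAt_r : HasDerivAt (fun t => (x.flow t).r) 1 0 :=
  (hasDerivAt_id (0 : ℝ)).const_add x.r

lemma hasDerivAt_δ :
    HasDerivAt (fun t => (x.flow t).δ i) (-(1 / 2) * (x.κ i * (x.δ i * x.δ i))) 0 := by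
  have h := (hasDerivAt_const (0 : ℝ) ‖x.d i‖).div (x.hasDerivAt_s i)
    (by rw [flow_zero]; exact (x.s_pos i).ne')
  refine h.congr_deriv ?_
  rw [flow_zero, δ, κ]
  have := (x.s_pos i).ne'
  field_simp
  ring

lemma hasDerivAt_κ :
    HasDerivAt (fun t => (x.flow t).κ i) (1 / 2 * (x.δ i + -1 * (x.δ i * (x.κ i * x.κ i)))) 0 := by
  have h := (x.hasDerivAt_r.const_mul ‖x.d i‖).div ((x.hasDerivAt_s i).const_mul 2)
    (by rw [flow_zero]; have := (x.s_pos i).ne'; positivity)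
  refine h.congr_deriv ?_
  rw [flow_zero, δ, κ]
  have := (x.s_pos i).ne'
  field_simp
  ring

lemma hasDerivAt_P : HasDerivAt (fun t => (x.flow t).P i) (x.D i) 0 := by
  simp only [P_eq]
  have h1 := ((x.hasDerivAt_s i).mul x.hasDerivAt_r).smul_const (x.v i)
  have h2 := (((x.hasDerivAt_r.pow 2).const_mul (‖x.d i‖ ^ 2)).div_const 2 |>.const_add
    1).smul_const x.u
  refine (h1.add h2).congr_deriv ?_
  rw [D, flow_zero, δ, κ]
  have h0 := (x.s_pos i).ne'
  have e := x.s_sq i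
  congr 2
  · field_simp
    linear_combination 4 * e
  · push_cast
    simp
    ring

lemma hasDerivAt_D : HasDerivAt (fun t => (x.flow t).D i)
    ((-(1 / 2) * (x.κ i * x.δ i)) • x.D i + (x.δ i * x.δ i) • x.P i) 0 := by
  have h0 := (x.s_pos i).ne'
  have e := x.s_sq i
  have h1 := ((((x.hasDerivAt_r.pow 2).const_mul (‖x.d i‖ ^ 2)).div_const 2 |>.const_add 1).div
    (x.hasDerivAt_s i) (by rwa [flow_zero])).smul_const (x.v i)
  have h2 := (x.hasDerivAt_r.const_mul (‖x.d i‖ ^ 2)).smul_const x.u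
  refine (h1.add h2).congr_deriv ?_
  rw [D, P_eq, flow_zero, δ, κ, smul_add, smul_add, add_add_add_comm, smul_smul, smul_smul,
    smul_smul, smul_smul, ← add_smul, ← add_smul]
  congr 2
  · rw [show ((fun t => (x.flow t).r) ^ 2) 0 = x.r ^ 2 by rw [Pi.pow_apply, flow_zero]]
    push_cast
    field_simp
    ring
  · field_simp
    linear_combination 4 * ‖x.d i‖ ^ 2 * e

lemma δ_nonneg : 0 ≤ x.δ i := div_nonneg (norm_nonneg _) (x.s_pos i).le

lemma norm_d_mul_r_le : ‖x.d i‖ * |x.r| ≤ 2 * x.s i := by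
  refine abs_le_of_sq_le_sq' ?_ (by linarith [x.s_pos i]) |>.2
  rw [mul_pow, mul_pow, s_sq, sq_abs]
  linarith

lemma δ_le : x.δ i ≤ 3 * x.gain := by
  rw [δ, gain, ← div_eq_mul_inv, div_le_div_iff₀ (x.s_pos i) (by positivity)]
  linarith [x.norm_d_mul_r_le i, x.norm_d_le i, x.one_le_s i]

lemma abs_κ_le : |x.κ i| ≤ 1 := by
  rw [κ, abs_div, abs_mul, abs_norm, abs_of_pos (by linarith [x.s_pos i] : 0 < 2 * x.s i)]
  exact (div_le_one (by linarith [x.s_pos i])).2 (x.norm_d_mul_r_le i)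

lemma norm_D_le : ‖x.D i‖ ≤ x.δ i * bracket (x.P i) := by
  refine abs_le_of_sq_le_sq' ?_ (mul_nonneg (x.δ_nonneg i) (bracket_pos _).le) |>.2
  have hs := (x.s_pos i).ne'
  have e := x.s_sq i
  have hu : ‖x.u‖ ^ 2 = bracket x.u ^ 2 - 1 := by rw [bracket_sq]; ring
  have h0 : 1 + bracket x.u ≠ 0 := by linarith [bracket_pos x.u]
  have hv : ‖x.v i‖ ^ 2 = ‖x.d i‖ ^ 2 + ⟪x.d i, x.u⟫_ℝ ^ 2 := by
    rw [v, norm_add_sq_real, inner_smul_right, norm_smul, mul_pow, hu, Real.norm_eq_abs, sq_abs]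
    field_simp
    ring
  have hvu : ⟪x.v i, x.u⟫_ℝ = bracket x.u * ⟪x.d i, x.u⟫_ℝ := by
    rw [v, inner_add_left, inner_smul_left, real_inner_self_eq_norm_sq, hu]
    simp only [conj_trivial]
    field_simp
    ring
  have hcs : ⟪x.d i, x.u⟫_ℝ ^ 2 ≤ ‖x.d i‖ ^ 2 * ‖x.u‖ ^ 2 := by
    rw [← mul_pow, ← sq_abs]
    gcongr
    exact abs_real_inner_le_norm _ _
  have key : (x.δ i * bracket (x.P i)) ^ 2 - ‖x.D i‖ ^ 2 =
      (‖x.d i‖ ^ 2 * ‖x.u‖ ^ 2 - ⟪x.d i, x.u⟫_ℝ ^ 2) / x.s i ^ 2 := by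
    rw [D, norm_add_sq_real, inner_smul_left, inner_smul_right, norm_smul, norm_smul, mul_pow,
      mul_pow, mul_pow, hv, hvu, hu, bracket_P, δ, Real.norm_eq_abs, sq_abs, Real.norm_eq_abs,
      sq_abs]
    simp only [conj_trivial]
    generalize ‖x.d i‖ = a at *
    generalize ⟪x.d i, x.u⟫_ℝ = b at *
    generalize bracket x.u = c at *
    generalize x.s i = s at *
    generalize x.r = r at *
    field_simp
    linear_combination (-4 * a ^ 2 * r ^ 2 * (a ^ 2 * (c ^ 2 - 1) - b ^ 2)) * e
  have := div_nonneg (sub_nonneg.2 hcs) (sq_nonneg (x.s i))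
  linarith

end RayPoint

end Ray

/-- A Schwartz function on `ℝ³ × ℝ³` decays faster than any power of the product of energies. -/
lemma SchwartzMap.exists_norm_le_bracket (g : SchwartzMap (V3 × V3) ℂ) (N : ℕ) :
    ∃ C, ∀ p q : V3, ‖g (p, q)‖ ≤ C * ((bracket p * bracket q) ^ N)⁻¹ := by
  refine ⟨2 ^ (2 * N) * (Finset.Iic (2 * N, 0)).sup
    (fun m => SchwartzMap.seminorm ℝ m.1 m.2) g, fun p q => ?_⟩
  have h := SchwartzMap.one_add_le_sup_seminorm_apply (𝕜 := ℝ) (m := (2 * N, 0)) (k := 2 * N)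
    (n := 0) le_rfl le_rfl g (p, q)
  rw [norm_iteratedFDeriv_zero] at h
  rw [← div_eq_mul_inv, le_div_iff₀ (by have := bracket_pos p; have := bracket_pos q; positivity),
    mul_comm]
  refine le_trans (mul_le_mul_of_nonneg_right ?_ (norm_nonneg _)) h
  rw [pow_mul]
  have hp := bracket_pos p
  have hq := bracket_pos q
  refine pow_le_pow_left₀ (by positivity) ?_ _
  rw [sq]
  have h1 : bracket p ≤ 1 + ‖(p, q)‖ := (bracket_le_one_add_norm p).trans
    (by linarith [norm_fst_le (p, q)])
  have h2 : bracket q ≤ 1 + ‖(p, q)‖ := (bracket_le_one_add_norm q).trans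
    (by linarith [norm_snd_le (p, q)])
  exact mul_le_mul h1 h2 hq.le (by positivity)

/-- The derivative of a Schwartz function along a curve, in coordinates. -/
lemma SchwartzMap.fderiv_prod_apply (g : SchwartzMap (V3 × V3) ℂ) (z : V3 × V3) (a b : V3) :
    fderiv ℝ g z (a, b) =
      ∑ j, ((a j : ℂ) * LineDeriv.lineDerivOp (EuclideanSpace.single j (1 : ℝ), (0 : V3)) g z +
        (b j : ℂ) * LineDeriv.lineDerivOp ((0 : V3), EuclideanSpace.single j (1 : ℝ)) g z) := by
  have hab : (a, b) = ∑ j, (a j • (EuclideanSpace.single j (1 : ℝ), (0 : V3)) +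
      b j • ((0 : V3), EuclideanSpace.single j (1 : ℝ))) := by
    have h : ∀ a : V3, a = ∑ j, a j • EuclideanSpace.single j (1 : ℝ) := fun a => by
      simpa using ((EuclideanSpace.basisFun (Fin 3) ℝ).sum_repr a).symm
    ext1
    · simpa [Prod.fst_sum] using h a
    · simpa [Prod.snd_sum] using h b
  conv_lhs => rw [hab]
  simp only [map_sum, map_add, map_smul, SchwartzMap.lineDerivOp_apply_eq_fderiv,
    Complex.real_smul]

section RaySymbol

namespace RayPoint

/-- Symbols along radial rays. -/
abbrev IsRaySymbol {A : Type*} [NormedRing A] [NormedAlgebra ℝ A] (n : ℕ) (w : RayPoint → ℝ)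
    (f : RayPoint → A) : Prop := IsSymbol flow gain n w f

variable {A : Type*} [NormedRing A] [NormedAlgebra ℝ A] {n : ℕ} {w w₁ w₂ : RayPoint → ℝ}
  {f g : RayPoint → A}

lemma IsRaySymbol.mul (hw₁ : ∀ x, 0 ≤ w₁ x) (hw₂ : ∀ x, 0 ≤ w₂ x) (hf : IsRaySymbol n w₁ f)
    (hg : IsRaySymbol n w₂ g) : IsRaySymbol n (fun x => w₁ x * w₂ x) (fun x => f x * g x) :=
  IsSymbol.mul flow_zero (fun x => x.gain_pos.le) hw₁ hw₂ hf hg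

lemma IsRaySymbol.const_mul (hw : ∀ x, 0 ≤ w x) (hf : IsRaySymbol n w f) (c : A) :
    IsRaySymbol n w (fun x => c * f x) :=
  IsSymbol.const_mul flow_zero (fun x => x.gain_pos.le) hw hf c

lemma gain_nonneg (x : RayPoint) : 0 ≤ x.gain := x.gain_pos.le

lemma isRaySymbol_δ_κ (i : Fin 2) (n : ℕ) :
    IsRaySymbol n gain (fun x => x.δ i) ∧ IsRaySymbol n (fun _ => 1) (fun x => x.κ i) := by
  have hδ : ∃ C, ∀ x : RayPoint, ‖x.δ i‖ ≤ C * x.gain :=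
    ⟨3, fun x => by rw [Real.norm_of_nonneg (x.δ_nonneg i)]; exact x.δ_le i⟩
  have hκ : ∃ C, ∀ x : RayPoint, ‖x.κ i‖ ≤ C * 1 := ⟨1, fun x => by simpa using x.abs_κ_le i⟩
  have one : ∀ x : RayPoint, (0 : ℝ) ≤ 1 := fun _ => zero_le_one
  have gg : ∀ x : RayPoint, 0 ≤ x.gain * x.gain := fun x => mul_self_nonneg _
  induction n with
  | zero => exact ⟨hδ, hκ⟩
  | succ n ih =>
    obtain ⟨h1, h2⟩ := ih
    refine ⟨IsSymbol.of_hasDerivAt hδ (fun x => x.hasDerivAt_δ i) ?_,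
      IsSymbol.of_hasDerivAt hκ (fun x => x.hasDerivAt_κ i) ?_⟩
    · have h := IsRaySymbol.mul one gg h2 (IsRaySymbol.mul gain_nonneg gain_nonneg h1 h1)
      exact (IsRaySymbol.const_mul (fun x => by simpa using gg x) h _).congr_weight
        fun x => one_mul _
    · have h := IsRaySymbol.mul gain_nonneg (fun x => by norm_num) h1 (IsRaySymbol.mul one one h2 h2)
      have h' := h.congr_weight (w₂ := gain) fun x => by ring
      exact (IsRaySymbol.const_mul gain_nonneg (h1.add (IsRaySymbol.const_mul gain_nonneg h' _))
        _).congr_weight fun x => (one_mul _).symm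

lemma isRaySymbol_s (i : Fin 2) (n : ℕ) : IsRaySymbol n (fun x => x.s i) (fun x => x.s i) := by
  have hs : ∃ C, ∀ x : RayPoint, ‖x.s i‖ ≤ C * x.s i :=
    ⟨1, fun x => by rw [Real.norm_of_nonneg (x.s_pos i).le, one_mul]⟩
  induction n with
  | zero => exact hs
  | succ n ih =>
    refine IsSymbol.of_hasDerivAt hs (fun x => x.hasDerivAt_s i) ?_
    obtain ⟨h1, h2⟩ := isRaySymbol_δ_κ i n
    have h := (IsRaySymbol.mul gain_nonneg (fun _ => zero_le_one) h1 h2).congr_weight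
      (w₂ := gain) fun x => mul_one _
    exact (IsRaySymbol.mul gain_nonneg (fun x => (x.s_pos i).le)
      (IsRaySymbol.const_mul gain_nonneg h _) ih).congr_weight fun x => mul_comm _ _

lemma abs_apply_le (p : V3) (j : Fin 3) : |p j| ≤ ‖p‖ := by
  simpa using PiLp.norm_apply_le p j

lemma isRaySymbol_P_D (i : Fin 2) (j : Fin 3) (n : ℕ) :
    IsRaySymbol n (fun x => bracket (x.P i)) (fun x => x.P i j) ∧
      IsRaySymbol n (fun x => bracket (x.P i) * x.gain) (fun x => x.D i j) := by
  have hP : ∃ C, ∀ x : RayPoint, ‖x.P i j‖ ≤ C * bracket (x.P i) :=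
    ⟨1, fun x => by rw [one_mul]; exact (abs_apply_le _ j).trans (norm_le_bracket _)⟩
  have hD : ∃ C, ∀ x : RayPoint, ‖x.D i j‖ ≤ C * (bracket (x.P i) * x.gain) :=
    ⟨3, fun x => ((abs_apply_le _ j).trans (x.norm_D_le i)).trans (by
      nlinarith [x.δ_le i, bracket_pos (x.P i)])⟩
  have hw : ∀ x : RayPoint, 0 ≤ bracket (x.P i) := fun x => (bracket_pos _).le
  have hw' : ∀ x : RayPoint, 0 ≤ bracket (x.P i) * x.gain := fun x =>
    mul_nonneg (hw x) x.gain_nonneg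
  have proj : ∀ {c : ℝ → V3} {c' : V3}, HasDerivAt c c' 0 →
      HasDerivAt (fun t => c t j) (c' j) 0 := fun hc =>
    ((EuclideanSpace.proj j : V3 →L[ℝ] ℝ).hasFDerivAt).comp_hasDerivAt (0 : ℝ) hc
  induction n with
  | zero => exact ⟨hP, hD⟩
  | succ n ih =>
    obtain ⟨h1, h2⟩ := ih
    obtain ⟨k1, k2⟩ := isRaySymbol_δ_κ i n
    refine ⟨IsSymbol.of_hasDerivAt hP (fun x => proj (x.hasDerivAt_P i)) h2,
      IsSymbol.of_hasDerivAt hD (fun x => proj (x.hasDerivAt_D i)) ?_⟩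
    have k3 := IsRaySymbol.const_mul gain_nonneg ((IsRaySymbol.mul (fun _ => zero_le_one)
      gain_nonneg k2 k1).congr_weight (w₂ := gain) fun x => one_mul _) (-(1 / 2))
    have k4 := IsRaySymbol.mul gain_nonneg gain_nonneg k1 k1
    have m1 := (IsRaySymbol.mul gain_nonneg hw' k3 h2).congr_weight
      (w₂ := fun x => bracket (x.P i) * x.gain * x.gain) fun x => by ring
    have m2 := (IsRaySymbol.mul (fun x => mul_self_nonneg _) hw k4 h1).congr_weight
      (w₂ := fun x => bracket (x.P i) * x.gain * x.gain) fun x => by ring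
    exact m1.add m2

lemma isRaySymbol_schwartz (g : SchwartzMap (V3 × V3) ℂ) (n N : ℕ) :
    IsRaySymbol n (fun x => (x.W ^ N)⁻¹) (fun x => g (x.P 0, x.P 1)) := by
  have hg : ∀ (g : SchwartzMap (V3 × V3) ℂ) (N : ℕ),
      ∃ C, ∀ x : RayPoint, ‖g (x.P 0, x.P 1)‖ ≤ C * (x.W ^ N)⁻¹ := fun g N => by
    obtain ⟨C, hC⟩ := g.exists_norm_le_bracket N
    exact ⟨C, fun x => hC _ _⟩
  have hW : ∀ N, ∀ x : RayPoint, 0 ≤ (x.W ^ N)⁻¹ := fun N x =>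
    inv_nonneg.2 (pow_nonneg x.W_pos.le _)
  induction n generalizing g N with
  | zero => exact hg g N
  | succ n ih =>
    refine IsSymbol.of_hasDerivAt (hg g N) (f' := fun x => fderiv ℝ g (x.P 0, x.P 1)
      (x.D 0, x.D 1)) (fun x => ?_) ?_
    · have h := (x.hasDerivAt_P 0).prodMk (x.hasDerivAt_P 1)
      have h' := (g.differentiableAt (x := ((x.flow 0).P 0, (x.flow 0).P 1))).hasFDerivAt
      have h'' := h'.comp_hasDerivAt (0 : ℝ) h
      simp only [flow_zero] at h''
      exact h''
    · simp only [SchwartzMap.fderiv_prod_apply]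
      have key : ∀ (i : Fin 2) (j : Fin 3) (h : SchwartzMap (V3 × V3) ℂ),
          IsRaySymbol n (fun x => (x.W ^ N)⁻¹ * x.gain)
            (fun x => (x.D i j : ℂ) * h (x.P 0, x.P 1)) := fun i j h => by
        have hw' : ∀ x : RayPoint, 0 ≤ bracket (x.P i) * x.gain := fun x =>
          mul_nonneg (bracket_pos _).le x.gain_nonneg
        refine (IsRaySymbol.mul hw' (hW (N + 1)) (isRaySymbol_P_D i j n).2.ofReal
          (ih h (N + 1))).mono gain_nonneg (fun x => mul_nonneg (hw' x) (hW _ x)) (K := 1)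
          fun x => ?_
        have h1 := x.bracket_P_le_W i
        have h2 := x.W_pos
        rw [one_mul, mul_right_comm]
        refine mul_le_mul_of_nonneg_right ?_ x.gain_nonneg
        rw [pow_succ, mul_inv, mul_left_comm, ← div_eq_mul_inv]
        exact mul_le_of_le_one_right (hW N x) ((div_le_one h2).2 h1)
      exact IsSymbol.sum _ gain_nonneg (fun x => mul_nonneg (hW N x) x.gain_nonneg)
        fun j _ => (key 0 j _).add (key 1 j _)

/-- The amplitude in the chart, including the Jacobian factor. -/
def amp (g : SchwartzMap (V3 × V3) ℂ) (x : RayPoint) : ℂ :=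
  (x.s 0 * x.s 1 : ℝ) * g (x.P 0, x.P 1)

lemma isRaySymbol_amp (g : SchwartzMap (V3 × V3) ℂ) (n N : ℕ) :
    IsRaySymbol n (fun x => x.s 0 * x.s 1 * (x.W ^ N)⁻¹) (amp g) := by
  have hs : ∀ i, ∀ x : RayPoint, 0 ≤ x.s i := fun i x => (x.s_pos i).le
  refine IsRaySymbol.mul (fun x => mul_nonneg (hs 0 x) (hs 1 x))
    (fun x => inv_nonneg.2 (pow_nonneg x.W_pos.le _)) ?_ (isRaySymbol_schwartz g n N)
  exact (IsRaySymbol.mul (hs 0) (hs 1) (isRaySymbol_s 0 n) (isRaySymbol_s 1 n)).ofReal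

end RayPoint

end RaySymbol

section RayIntegral

namespace RayPoint

/-- The weight `s₀ s₁ W⁻ᴺ`. -/
def weight (N : ℕ) (x : RayPoint) : ℝ := x.s 0 * x.s 1 * (x.W ^ N)⁻¹

lemma weight_nonneg (N : ℕ) (x : RayPoint) : 0 ≤ x.weight N :=
  mul_nonneg (mul_nonneg (x.s_pos 0).le (x.s_pos 1).le) (inv_nonneg.2 (pow_nonneg x.W_pos.le _))

/-- The `k`-th radial derivative of the amplitude. -/
def ampDeriv (g : SchwartzMap (V3 × V3) ℂ) (k : ℕ) : RayPoint → ℂ := (flowDeriv flow)^[k] (amp g)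

lemma ampDeriv_succ (g : SchwartzMap (V3 × V3) ℂ) (k : ℕ) :
    ampDeriv g (k + 1) = flowDeriv flow (ampDeriv g k) :=
  Function.iterate_succ_apply' _ _ _

lemma isRaySymbol_ampDeriv (g : SchwartzMap (V3 × V3) ℂ) (k n N : ℕ) :
    IsRaySymbol n (fun x => x.weight N * x.gain ^ k) (ampDeriv g k) := by
  induction k generalizing n with
  | zero => exact (isRaySymbol_amp g n N).congr_weight fun x => by simp [weight]
  | succ k ih =>
    have h := (ih (n + 1)).flowDeriv
    rw [ampDeriv_succ]
    exact h.congr_weight fun x => by rw [pow_succ, mul_assoc]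

lemma exists_norm_ampDeriv_le (g : SchwartzMap (V3 × V3) ℂ) (N : ℕ) :
    ∃ C, 0 ≤ C ∧ ∀ k ≤ 4, ∀ x, ‖ampDeriv g k x‖ ≤ C * (x.weight N * x.gain ^ k) := by
  have h : ∀ k, ∃ C, 0 ≤ C ∧ ∀ x, ‖ampDeriv g k x‖ ≤ C * (x.weight N * x.gain ^ k) := fun k =>
    (isRaySymbol_ampDeriv g k 0 N).exists_bound fun x =>
      mul_nonneg (x.weight_nonneg N) (pow_nonneg x.gain_nonneg _)
  choose C hC0 hC using h
  refine ⟨∑ k ∈ Finset.range 5, C k, Finset.sum_nonneg fun k _ => hC0 k, fun k hk x =>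
    (hC k x).trans (mul_le_mul_of_nonneg_right ?_
      (mul_nonneg (x.weight_nonneg N) (pow_nonneg x.gain_nonneg _)))⟩
  exact Finset.single_le_sum (f := C) (fun k _ => hC0 k) (Finset.mem_range.2 (by omega))

variable {u : V3} {d : Fin 2 → V3} (hd : ∀ i, ‖d i‖ ≤ 1)

lemma hasDerivAt_ampDeriv (g : SchwartzMap (V3 × V3) ℂ) (k : ℕ) (r : ℝ) :
    HasDerivAt (fun r => ampDeriv g k ⟨u, d, r, hd⟩) (ampDeriv g (k + 1) ⟨u, d, r, hd⟩) r := by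
  have h := (isRaySymbol_ampDeriv g k 1 0).hasDerivAt ⟨u, d, r, hd⟩
  have h' : HasDerivAt (fun t => ampDeriv g k ⟨u, d, r + t, hd⟩)
      (ampDeriv g (k + 1) ⟨u, d, r, hd⟩) (r - r) := by
    rw [sub_self, ampDeriv_succ]
    exact h
  have h'' := h'.comp_sub_const r r
  simpa using h''

/-- The `k`-th radial derivative of the even part of the amplitude. -/
def evenDeriv (g : SchwartzMap (V3 × V3) ℂ) (k : ℕ) (r : ℝ) : ℂ :=
  (ampDeriv g k ⟨u, d, r, hd⟩ + (-1) ^ k * ampDeriv g k ⟨u, d, -r, hd⟩) / 2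

lemma hasDerivAt_evenDeriv (g : SchwartzMap (V3 × V3) ℂ) (k : ℕ) (r : ℝ) :
    HasDerivAt (evenDeriv (u := u) hd g k) (evenDeriv (u := u) hd g (k + 1) r) r := by
  have h := hasDerivAt_ampDeriv (u := u) hd g k r
  have h' := (hasDerivAt_ampDeriv (u := u) hd g k (-r)).scomp r (hasDerivAt_neg r)
  refine ((h.add (h'.const_mul ((-1) ^ k))).div_const 2).congr_deriv ?_
  rw [evenDeriv]
  simp
  ring

lemma bracket_u_le (x : RayPoint) : bracket x.u ≤ (2 + x.r ^ 2) * x.W := by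
  have h := bracket_le_two_mul_mul_boost x.u (stretch (x.r • x.d 0) • (x.r • x.d 0))
  have h1 := x.bracket_P_le_W 0
  rw [bracket_stretch_smul, norm_smul, Real.norm_eq_abs, mul_pow, sq_abs] at h
  have h2 : x.r ^ 2 * ‖x.d 0‖ ^ 2 ≤ x.r ^ 2 :=
    mul_le_of_le_one_right (sq_nonneg _) (pow_le_one₀ (norm_nonneg _) (x.norm_d_le 0))
  refine h.trans (mul_le_mul (by linarith) h1 (bracket_pos _).le (by positivity))

lemma one_add_sq_le (x : RayPoint) (hx : ‖x.d 0‖ ^ 2 + ‖x.d 1‖ ^ 2 = 1) :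
    1 + x.r ^ 2 / 2 ≤ 4 * bracket x.u ^ 2 * x.W := by
  have h : ∀ i, 1 + x.r ^ 2 * ‖x.d i‖ ^ 2 / 2 ≤ 2 * bracket x.u * bracket (x.P i) := fun i => by
    have h := bracket_le_two_mul_boost x.u (stretch (x.r • x.d i) • (x.r • x.d i))
    rwa [bracket_stretch_smul, norm_smul, Real.norm_eq_abs, mul_pow, sq_abs] at h
  have h01 := mul_le_mul (h 0) (h 1) (by positivity)
    (mul_nonneg (mul_nonneg zero_le_two (bracket_pos _).le) (bracket_pos _).le)
  calc 1 + x.r ^ 2 / 2 = 1 + x.r ^ 2 * (‖x.d 0‖ ^ 2 + ‖x.d 1‖ ^ 2) / 2 := by rw [hx, mul_one]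
    _ ≤ (1 + x.r ^ 2 * ‖x.d 0‖ ^ 2 / 2) * (1 + x.r ^ 2 * ‖x.d 1‖ ^ 2 / 2) := by
      nlinarith [mul_nonneg (mul_nonneg (sq_nonneg x.r) (sq_nonneg ‖x.d 0‖))
        (mul_nonneg (sq_nonneg x.r) (sq_nonneg ‖x.d 1‖))]
    _ ≤ _ := h01
    _ = _ := by rw [W]; ring

lemma s_le (x : RayPoint) (i : Fin 2) : x.s i ≤ 1 + x.r ^ 2 := by
  refine abs_le_of_sq_le_sq' ?_ (by positivity) |>.2
  rw [s_sq]
  have h2 : ‖x.d i‖ ^ 2 * x.r ^ 2 ≤ x.r ^ 2 :=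
    mul_le_of_le_one_left (sq_nonneg _) (pow_le_one₀ (norm_nonneg _) (x.norm_d_le i))
  nlinarith [sq_nonneg x.r]

lemma weight_le_near (x : RayPoint) (hr : |x.r| ≤ 1) :
    x.weight 7 ≤ 324 * (bracket x.u ^ 4)⁻¹ := by
  have hr2 : x.r ^ 2 ≤ 1 := by rw [← sq_abs]; exact pow_le_one₀ (abs_nonneg _) hr
  have hs : ∀ i, x.s i ≤ 2 := fun i => (x.s_le i).trans (by linarith)
  have hu : bracket x.u ≤ 3 * x.W := x.bracket_u_le.trans (by nlinarith [x.W_pos])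
  have hss : x.s 0 * x.s 1 ≤ 2 * 2 := mul_le_mul (hs 0) (hs 1) (x.s_pos 1).le zero_le_two
  have hW : (x.W ^ 7)⁻¹ ≤ 81 * (bracket x.u ^ 4)⁻¹ := by
    rw [← div_eq_mul_inv, inv_eq_one_div, div_le_div_iff₀ (pow_pos x.W_pos _)
      (pow_pos (bracket_pos _) _), one_mul]
    calc bracket x.u ^ 4 ≤ (3 * x.W) ^ 4 := pow_le_pow_left₀ (bracket_pos _).le hu 4
      _ = 81 * x.W ^ 4 := by ring
      _ ≤ 81 * x.W ^ 7 := by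
        have := pow_le_pow_right₀ x.one_le_W (show 4 ≤ 7 by norm_num)
        linarith
  calc x.weight 7 ≤ 2 * 2 * (81 * (bracket x.u ^ 4)⁻¹) :=
        mul_le_mul hss hW (inv_nonneg.2 (pow_nonneg x.W_pos.le _)) (by norm_num)
    _ = _ := by ring

lemma weight_le_far (x : RayPoint) (hr : 1 ≤ |x.r|) :
    x.weight 7 ≤ 81 * (bracket x.u ^ 4)⁻¹ * (|x.r| ^ 8 * x.weight 3) := by
  have hr2 : 1 ≤ x.r ^ 2 := by rw [← sq_abs]; exact one_le_pow₀ hr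
  have hW := x.W_pos
  have hu : bracket x.u ≤ 3 * x.r ^ 2 * x.W := x.bracket_u_le.trans (by nlinarith)
  have hu4 : bracket x.u ^ 4 ≤ 81 * (|x.r| ^ 8 * x.W ^ 4) := by
    calc bracket x.u ^ 4 ≤ (3 * x.r ^ 2 * x.W) ^ 4 := pow_le_pow_left₀ (bracket_pos _).le hu 4
      _ = _ := by rw [← sq_abs]; ring
  have hb := pow_pos (bracket_pos x.u) 4
  have e : 81 * (bracket x.u ^ 4)⁻¹ * (|x.r| ^ 8 * x.weight 3) =
      (81 * (|x.r| ^ 8 * x.W ^ 4) / bracket x.u ^ 4) * x.weight 7 := by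
    rw [weight, weight]
    field_simp
  rw [e]
  exact le_mul_of_one_le_left (x.weight_nonneg 7) ((one_le_div hb).2 hu4)

lemma weight_le_decay (x : RayPoint) (hx : ‖x.d 0‖ ^ 2 + ‖x.d 1‖ ^ 2 = 1) (hr : 1 ≤ |x.r|) :
    x.weight 7 ≤ 4 * (8 * bracket x.u ^ 2) ^ 7 / |x.r| ^ 7 := by
  have hr0 : 0 < |x.r| := zero_lt_one.trans_le hr
  have hr2 : 1 ≤ |x.r| ^ 2 := one_le_pow₀ hr
  have hs : ∀ i, x.s i ≤ 2 * |x.r| ^ 2 := fun i => (x.s_le i).trans (by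
    rw [← sq_abs]; linarith)
  have hss : x.s 0 * x.s 1 ≤ (2 * |x.r| ^ 2) * (2 * |x.r| ^ 2) :=
    mul_le_mul (hs 0) (hs 1) (x.s_pos 1).le (by positivity)
  have hb := bracket_pos x.u
  have hW : |x.r| ^ 2 ≤ 8 * bracket x.u ^ 2 * x.W := by
    have := x.one_add_sq_le hx
    rw [sq_abs]
    linarith
  have hW7 : (x.W ^ 7)⁻¹ ≤ (8 * bracket x.u ^ 2) ^ 7 / |x.r| ^ 14 := by
    rw [inv_eq_one_div, div_le_div_iff₀ (pow_pos x.W_pos _) (by positivity), one_mul, ← mul_pow]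
    calc |x.r| ^ 14 = (|x.r| ^ 2) ^ 7 := by ring
      _ ≤ _ := pow_le_pow_left₀ (by positivity) hW 7
  calc x.weight 7 ≤ (2 * |x.r| ^ 2) * (2 * |x.r| ^ 2) * ((8 * bracket x.u ^ 2) ^ 7 / |x.r| ^ 14) :=
        mul_le_mul hss hW7 (inv_nonneg.2 (pow_nonneg x.W_pos.le _)) (by positivity)
    _ = 4 * (8 * bracket x.u ^ 2) ^ 7 / |x.r| ^ 10 := by field_simp; ring
    _ ≤ _ := by
      have := pow_le_pow_right₀ hr (show 7 ≤ 10 by norm_num)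
      gcongr

/-- The even part of the weight along a ray. -/
def evenWeight (u : V3) {d : Fin 2 → V3} (hd : ∀ i, ‖d i‖ ≤ 1) (N : ℕ) (r : ℝ) : ℝ :=
  weight N ⟨u, d, r, hd⟩ + weight N ⟨u, d, -r, hd⟩

lemma norm_evenDeriv_le {g : SchwartzMap (V3 × V3) ℂ} {N : ℕ} {C : ℝ} {k : ℕ}
    (hC : ∀ x, ‖ampDeriv g k x‖ ≤ C * (x.weight N * x.gain ^ k)) (r : ℝ) :
    ‖evenDeriv (u := u) hd g k r‖ ≤ C * evenWeight u hd N r * ((1 + |r|)⁻¹) ^ k := by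
  have h1 := hC ⟨u, d, r, hd⟩
  have h2 := hC ⟨u, d, -r, hd⟩
  simp only [gain, abs_neg] at h1 h2
  rw [evenDeriv, norm_div, RCLike.norm_ofNat, div_le_iff₀ zero_lt_two, evenWeight]
  refine (norm_add_le _ _).trans ?_
  have h0 := norm_nonneg (ampDeriv g k ⟨u, d, r, hd⟩)
  have h0' := norm_nonneg (ampDeriv g k ⟨u, d, -r, hd⟩)
  rw [norm_mul, norm_pow, norm_neg, norm_one, one_pow, one_mul]
  linarith

lemma amp_zero (g : SchwartzMap (V3 × V3) ℂ) : amp g ⟨u, d, 0, hd⟩ = g (u, u) := by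
  simp [amp, s, P, stretch, chart, boost, bracket]

/-- Stationary phase along a ray, uniformly in the velocity and the direction. -/
lemma exists_ray_estimate (g : SchwartzMap (V3 × V3) ℂ) :
    ∃ C, 0 ≤ C ∧ ∀ (u : V3) (d : Fin 2 → V3) (hd : ∀ i, ‖d i‖ ≤ 1),
      ‖d 0‖ ^ 2 + ‖d 1‖ ^ 2 = 1 → ∀ μ : ℝ, μ ≠ 0 →
      IntegrableOn (fun r : ℝ => r ^ 5 * evenWeight u hd 3 r) (Set.Ioi 0) →
      ‖(∫ r in Set.Ioi (0 : ℝ), (r : ℂ) ^ 5 *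
          ((amp g ⟨u, d, r, hd⟩ + amp g ⟨u, d, -r, hd⟩) / 2) * cexp (-(I * μ * r ^ 2 / 2))) -
          8 * g (u, u) / (I * μ) ^ 3‖ ≤
        C * (bracket u ^ 4)⁻¹ * (|μ| ^ 4)⁻¹ *
          (1 + ∫ r in Set.Ioi (0 : ℝ), r ^ 5 * evenWeight u hd 3 r) := by
  obtain ⟨C, hC0, hC⟩ := exists_norm_ampDeriv_le g 7
  refine ⟨50 * 648 * C, by positivity, fun u d hd hd1 μ hμ hInt => ?_⟩
  set F : ℕ → ℝ → ℂ := fun k => evenDeriv (u := u) hd g k with hF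
  have hFd : ∀ k r, HasDerivAt (F k) (F (k + 1) r) r := hasDerivAt_evenDeriv hd g
  have hFc : ∀ k, Continuous (F k) := fun k =>
    continuous_iff_continuousAt.2 fun r => (hFd k r).continuousAt
  have hb := pow_pos (bracket_pos u) 4
  set B := (bracket u ^ 4)⁻¹ with hB
  have hB0 : 0 < B := inv_pos.2 hb
  have hEW0 : ∀ N r, 0 ≤ evenWeight u hd N r := fun N r =>
    add_nonneg (weight_nonneg _ _) (weight_nonneg _ _)
  have hFle : ∀ k ≤ 4, ∀ r, ‖F k r‖ ≤ C * evenWeight u hd 7 r * ((1 + |r|)⁻¹) ^ k :=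
    fun k hk r => norm_evenDeriv_le hd (hC k hk) r
  have hgain : ∀ r : ℝ, (1 + |r|)⁻¹ ≤ 1 := fun r =>
    inv_le_one_of_one_le₀ (by linarith [abs_nonneg r])
  have hFle1 : ∀ k ≤ 4, ∀ r, ‖F k r‖ ≤ C * evenWeight u hd 7 r := fun k hk r =>
    (hFle k hk r).trans (mul_le_of_le_one_right (mul_nonneg hC0 (hEW0 _ _))
      (pow_le_one₀ (by positivity) (hgain r)))
  have hnear : ∀ k ≤ 4, ∀ r, |r| ≤ 1 → ‖F k r‖ ≤ 648 * C * B := fun k hk r hr => by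
    refine (hFle1 k hk r).trans ?_
    have h1 := weight_le_near ⟨u, d, r, hd⟩ hr
    have h2 := weight_le_near ⟨u, d, -r, hd⟩ (by simpa using hr)
    have : evenWeight u hd 7 r ≤ 648 * B := by
      rw [evenWeight]; simp only at h1 h2; linarith
    calc C * evenWeight u hd 7 r ≤ C * (648 * B) := mul_le_mul_of_nonneg_left this hC0
      _ = _ := by ring
  have hfar : ∀ r, 1 ≤ r → evenWeight u hd 7 r ≤ 81 * B * (r ^ 8 * evenWeight u hd 3 r) :=
    fun r hr => by
      have hr0 : |r| = r := abs_of_nonneg (by linarith)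
      have h1 := weight_le_far ⟨u, d, r, hd⟩ (by simpa [hr0] using hr)
      have h2 := weight_le_far ⟨u, d, -r, hd⟩ (by simpa [hr0] using hr)
      simp only [abs_neg, hr0] at h1 h2
      rw [evenWeight, evenWeight]
      linarith
  have hdecay : ∀ k ≤ 4, ∀ r, 1 ≤ r →
      ‖F k r‖ ≤ C * (2 * (4 * (8 * bracket u ^ 2) ^ 7)) / r ^ 7 := fun k hk r hr => by
    refine (hFle1 k hk r).trans ?_
    have hr0 : |r| = r := abs_of_nonneg (by linarith)
    have h1 := weight_le_decay ⟨u, d, r, hd⟩ hd1 (by simpa [hr0] using hr)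
    have h2 := weight_le_decay ⟨u, d, -r, hd⟩ hd1 (by simpa [hr0] using hr)
    simp only [abs_neg, hr0] at h1 h2
    have : evenWeight u hd 7 r ≤ 2 * (4 * (8 * bracket u ^ 2) ^ 7) / r ^ 7 := by
      rw [evenWeight, mul_div_assoc]; linarith
    calc C * evenWeight u hd 7 r ≤ C * (2 * (4 * (8 * bracket u ^ 2) ^ 7) / r ^ 7) :=
          mul_le_mul_of_nonneg_left this hC0
      _ = _ := by ring
  have hF10 : F 1 0 = 0 := by simp [hF, evenDeriv]
  set R : ℝ → ℂ := fun r => 15 * (F 2 r / r - F 1 r / r ^ 2) + 10 * F 3 r + r * F 4 r with hR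
  have hRnear : ∀ r, 0 < r → r ≤ 1 → ‖R r‖ ≤ 26 * (648 * C * B) := by
    intro r hr hr1
    set S := 648 * C * B
    have hh : ∀ q : ℝ, HasDerivAt (fun q : ℝ => (q : ℂ) * F 2 q - F 1 q) (q * F 3 q) q :=
      fun q => by
        have h1 : HasDerivAt (fun r : ℝ => (r : ℂ)) 1 q := Complex.ofRealCLM.hasDerivAt
        refine ((h1.mul (hFd 2 q)).sub (hFd 1 q)).congr_deriv ?_
        ring
    have hmv := norm_image_sub_le_of_norm_deriv_le_segment' (a := 0) (b := r) (C := r * S)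
      (fun q _ => (hh q).hasDerivWithinAt) (fun q hq => by
        rw [norm_mul, Complex.norm_real, Real.norm_of_nonneg hq.1]
        exact mul_le_mul hq.2.le (hnear 3 (by norm_num) q
          (by rw [abs_of_nonneg hq.1]; linarith [hq.2])) (norm_nonneg _) hr.le) r
      (Set.right_mem_Icc.2 hr.le)
    have hrC : (r : ℂ) ≠ 0 := by exact_mod_cast hr.ne'
    have hnr : ‖(r : ℂ)‖ = r := by rw [Complex.norm_real, Real.norm_of_nonneg hr.le]
    have e1 : ‖F 2 r / r - F 1 r / r ^ 2‖ ≤ S := by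
      have : F 2 r / r - F 1 r / r ^ 2 = (r * F 2 r - F 1 r) / r ^ 2 := by field_simp
      rw [this, norm_div, norm_pow, hnr, div_le_iff₀ (by positivity)]
      simpa [hF10, mul_comm, mul_assoc, mul_left_comm, sq] using hmv
    have hrabs : |r| ≤ 1 := by rwa [abs_of_pos hr]
    have e3 := hnear 3 (by norm_num) r hrabs
    have e4 := hnear 4 (by norm_num) r hrabs
    refine norm_add₃_le.trans ?_
    simp only [norm_mul, hnr, RCLike.norm_ofNat]
    nlinarith [norm_nonneg (F 4 r)]
  have hRfar : ∀ r, 1 ≤ r → ‖R r‖ ≤ 41 * (81 * C * B) * (r ^ 5 * evenWeight u hd 3 r) := by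
    intro r hr
    have hr0 : 0 < r := zero_lt_one.trans_le hr
    have hnr : ‖(r : ℂ)‖ = r := by rw [Complex.norm_real, Real.norm_of_nonneg hr0.le]
    have hk : ∀ k ≤ 4, r ^ k * ‖F k r‖ ≤ C * evenWeight u hd 7 r := fun k hk => by
      have h := hFle k hk r
      rw [abs_of_pos hr0, inv_pow, ← div_eq_mul_inv, le_div_iff₀ (by positivity)] at h
      refine le_trans ?_ h
      rw [mul_comm]
      gcongr
      linarith
    have hE := hEW0 7 r
    have key : r ^ 3 * ‖R r‖ ≤ 41 * (C * evenWeight u hd 7 r) := by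
      have hRr : ‖R r‖ ≤ 15 * (‖F 2 r‖ / r + ‖F 1 r‖ / r ^ 2) + 10 * ‖F 3 r‖ + r * ‖F 4 r‖ := by
        refine norm_add₃_le.trans ?_
        simp only [norm_mul, hnr, RCLike.norm_ofNat]
        have := norm_sub_le (F 2 r / r) (F 1 r / r ^ 2)
        simp only [norm_div, norm_pow, hnr] at this
        linarith
      calc r ^ 3 * ‖R r‖ ≤ r ^ 3 * (15 * (‖F 2 r‖ / r + ‖F 1 r‖ / r ^ 2) + 10 * ‖F 3 r‖ +
            r * ‖F 4 r‖) := mul_le_mul_of_nonneg_left hRr (by positivity)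
        _ = 15 * (r ^ 2 * ‖F 2 r‖) + 15 * (r ^ 1 * ‖F 1 r‖) + 10 * (r ^ 3 * ‖F 3 r‖) +
            r ^ 4 * ‖F 4 r‖ := by field_simp
        _ ≤ _ := by
          linarith [hk 1 (by norm_num), hk 2 (by norm_num), hk 3 (by norm_num), hk 4 le_rfl]
    have h7 := mul_le_mul_of_nonneg_left (hfar r hr) hC0
    have : r ^ 3 * ‖R r‖ ≤ r ^ 3 * (41 * (81 * C * B) * (r ^ 5 * evenWeight u hd 3 r)) := by
      calc r ^ 3 * ‖R r‖ ≤ 41 * (C * (81 * B * (r ^ 8 * evenWeight u hd 3 r))) := by linarith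
        _ = _ := by ring
    exact le_of_mul_le_mul_left this (by positivity)
  set w : ℝ → ℝ := fun r => (Set.Ioc (0 : ℝ) 1).indicator (fun _ => 1) r +
    r ^ 5 * evenWeight u hd 3 r with hw
  have hind : IntegrableOn ((Set.Ioc (0 : ℝ) 1).indicator (fun _ => (1 : ℝ))) (Set.Ioi 0) :=
    ((integrable_indicator_iff measurableSet_Ioc).2
      (integrableOn_const (by simp))).integrableOn
  have hwint : IntegrableOn w (Set.Ioi 0) := hind.add hInt
  have hRw : ∀ r ∈ Set.Ioi (0 : ℝ), ‖R r‖ ≤ 26 * (648 * C * B) * w r := by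
    intro r hr
    have hr0 : 0 < r := hr
    have hn : 0 ≤ r ^ 5 * evenWeight u hd 3 r := mul_nonneg (by positivity) (hEW0 3 r)
    have hCB : 0 ≤ C * B := mul_nonneg hC0 hB0.le
    rcases le_total r 1 with h | h
    · have : w r = 1 + r ^ 5 * evenWeight u hd 3 r := by
        simp only [hw, Set.indicator_of_mem (show r ∈ Set.Ioc (0 : ℝ) 1 from ⟨hr0, h⟩)]
      rw [this]
      nlinarith [hRnear r hr0 h, mul_nonneg hCB hn]
    · have : r ^ 5 * evenWeight u hd 3 r ≤ w r :=
        le_add_of_nonneg_left (Set.indicator_nonneg (fun _ _ => zero_le_one) _)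
      nlinarith [hRfar r h, mul_nonneg hCB (sub_nonneg.2 this), mul_nonneg hCB hn]
  have hF4 : Measurable (F 4) := by
    have : F 4 = deriv (F 3) := funext fun r => ((hFd 3 r).deriv).symm
    rw [this]
    exact measurable_deriv _
  have hRint : IntegrableOn R (Set.Ioi 0) := by
    refine Integrable.mono' (hwint.const_mul (26 * (648 * C * B))) ?_
      ((ae_restrict_iff' measurableSet_Ioi).2 (Filter.Eventually.of_forall hRw))
    have m1 := (hFc 1).measurable
    have m2 := (hFc 2).measurable
    have m3 := (hFc 3).measurable
    exact Measurable.aestronglyMeasurable (by fun_prop)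
  have main := integral_radial_quadratic_phase (hFd 0) (hFd 1) (hFd 2) (hFd 3) hF10 hμ
    (hdecay 0 (by norm_num)) (hdecay 1 (by norm_num)) (hdecay 2 (by norm_num))
    (hdecay 3 (by norm_num)) hRint
  have hF0 : ∀ r : ℝ, F 0 r = (amp g ⟨u, d, r, hd⟩ + amp g ⟨u, d, -r, hd⟩) / 2 := fun r => by
    simp [hF, evenDeriv, ampDeriv]
  have hF00 : F 0 0 = g (u, u) := by rw [hF0, neg_zero, amp_zero]; ring
  simp only [hF0] at main
  rw [main, ← hF0, hF00, add_sub_cancel_left, norm_mul, zpow_neg, norm_inv]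
  have hcn : ‖(I * (μ : ℂ)) ^ (4 : ℤ)‖ = |μ| ^ 4 := by
    norm_cast
    simp
  rw [hcn, mul_comm, mul_right_comm]
  refine mul_le_mul_of_nonneg_right ?_ (by positivity)
  have hIR : ‖∫ r in Set.Ioi (0 : ℝ), R r * cexp (-(I * μ * r ^ 2 / 2))‖ ≤
      ∫ r in Set.Ioi (0 : ℝ), 26 * (648 * C * B) * w r := by
    refine norm_integral_le_of_norm_le (hwint.const_mul _)
      ((ae_restrict_iff' measurableSet_Ioi).2 (Filter.Eventually.of_forall fun r hr => ?_))
    rw [norm_mul, norm_cexp_quadratic, mul_one]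
    exact hRw r hr
  have hIw : ∫ r in Set.Ioi (0 : ℝ), w r =
      1 + ∫ r in Set.Ioi (0 : ℝ), r ^ 5 * evenWeight u hd 3 r := by
    rw [hw, integral_add hind hInt]
    congr 1
    rw [setIntegral_indicator measurableSet_Ioc, Set.inter_eq_right.2 Set.Ioc_subset_Ioi_self]
    simp
  rw [integral_const_mul, hIw] at hIR
  have hJ : 0 ≤ ∫ r in Set.Ioi (0 : ℝ), r ^ 5 * evenWeight u hd 3 r :=
    setIntegral_nonneg measurableSet_Ioi fun r hr =>
      mul_nonneg (pow_nonneg (le_of_lt hr) 5) (hEW0 3 r)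
  have hF2 := hnear 2 (by norm_num) 0 (by simp)
  refine (norm_add_le _ _).trans ?_
  rw [norm_mul, RCLike.norm_ofNat]
  nlinarith [mul_nonneg (mul_nonneg hC0 hB0.le) hJ]

end RayPoint

end RayIntegral

/-! ### Polar coordinates -/

section Polar

open Module Set Function

variable {E F : Type*} [NormedAddCommGroup E] [NormedSpace ℝ E] [MeasurableSpace E] [BorelSpace E]
  [FiniteDimensional ℝ E] [NormedAddCommGroup F] [NormedSpace ℝ F]

/-- Integration in polar coordinates. -/
lemma integral_polar (μ : Measure E) [μ.IsAddHaarMeasure] [Nontrivial E] {H : E → F}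
    (hH : Integrable H μ) :
    (∀ᵐ θ : Metric.sphere (0 : E) 1 ∂μ.toSphere,
        IntegrableOn (fun r : ℝ => r ^ (finrank ℝ E - 1) • H (r • (θ : E))) (Ioi 0)) ∧
      Integrable (fun θ : Metric.sphere (0 : E) 1 =>
        ∫ r in Ioi (0 : ℝ), r ^ (finrank ℝ E - 1) • H (r • (θ : E))) μ.toSphere ∧
      ∫ θ : Metric.sphere (0 : E) 1, (∫ r in Ioi (0 : ℝ),
        r ^ (finrank ℝ E - 1) • H (r • (θ : E))) ∂μ.toSphere = ∫ Y, H Y ∂μ := by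
  set k := finrank ℝ E - 1 with hk
  set G : Metric.sphere (0 : E) 1 × Ioi (0 : ℝ) → F := fun z => H ((z.2 : ℝ) • (z.1 : E)) with hG
  have hcomp : ∀ Y : ({0}ᶜ : Set E), G (homeomorphUnitSphereProd E Y) = H Y := fun Y => by
    have h : ‖(Y : E)‖ ≠ 0 := norm_ne_zero_iff.2 Y.2
    simp [hG, smul_smul, h]
  have mp := μ.measurePreserving_homeomorphUnitSphereProd
  have hGint : Integrable G (μ.toSphere.prod (.volumeIoiPow k)) := by
    rw [← mp.integrable_comp_emb (Homeomorph.measurableEmbedding _)]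
    have : G ∘ homeomorphUnitSphereProd E = H ∘ Subtype.val := funext hcomp
    rw [this, ← integrableOn_iff_comap_subtypeVal (by measurability), IntegrableOn,
      restrict_compl_singleton]
    exact hH
  have hGeq : ∫ z, G z ∂μ.toSphere.prod (.volumeIoiPow k) = ∫ Y, H Y ∂μ := by
    rw [← mp.integral_comp (Homeomorph.measurableEmbedding _) G]
    simp only [hcomp]
    rw [integral_subtype_comap (measurableSet_singleton _).compl fun x => H x,
      restrict_compl_singleton]
  have hInt : ∀ h : ℝ → F, Integrable (fun r : Ioi (0 : ℝ) => h r) (.volumeIoiPow k) ↔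
      IntegrableOn (fun r : ℝ => r ^ k • h r) (Ioi 0) := fun h => by
    rw [integrableOn_iff_comap_subtypeVal measurableSet_Ioi, comp_def, Measure.volumeIoiPow,
      integrable_withDensity_iff_integrable_smul', integrable_congr]
    · refine .of_forall ?_
      rintro ⟨x, hx : 0 < x⟩
      simp (disch := positivity) [ENNReal.toReal_ofReal]
    · fun_prop
    · simp
  have hval : ∀ h : ℝ → F, ∫ r : Ioi (0 : ℝ), h r ∂(.volumeIoiPow k) =
      ∫ r in Ioi (0 : ℝ), r ^ k • h r := fun h => by
    simp only [Measure.volumeIoiPow, ENNReal.ofReal]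
    rw [integral_withDensity_eq_integral_smul,
      integral_subtype_comap measurableSet_Ioi fun a ↦ Real.toNNReal (a ^ k) • h a,
      setIntegral_congr_fun measurableSet_Ioi fun x hx ↦ ?_]
    · rw [NNReal.smul_def, Real.coe_toNNReal _ (pow_nonneg hx.out.le _)]
    · exact (measurable_subtype_coe.pow_const _).real_toNNReal
  refine ⟨?_, ?_, ?_⟩
  · filter_upwards [hGint.prod_right_ae] with θ hθ
    exact (hInt fun r => H (r • (θ : E))).1 hθ
  · exact hGint.integral_prod_left.congr (.of_forall fun θ => hval fun r => H (r • (θ : E)))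
  · rw [← hGeq, integral_prod _ hGint]
    exact integral_congr_ae (.of_forall fun θ => (hval fun r => H (r • (θ : E))).symm)

end Polar

/-- The area of the unit sphere in `ℝ³ × ℝ³`. -/
lemma toSphere_real_univ_prod :
    (volume : Measure (WithLp 2 (V3 × V3))).toSphere.real Set.univ = π ^ 3 := by
  have hdim : Module.finrank ℝ (WithLp 2 (V3 × V3)) = 6 := by
    rw [LinearEquiv.finrank_eq (WithLp.linearEquiv 2 ℝ (V3 × V3))]
    simp
  rw [Measure.toSphere_real_apply_univ, hdim, Measure.real,
    InnerProductSpace.volume_ball, hdim, ENNReal.toReal_mul]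
  simp only [ENNReal.ofReal_one, one_pow, ENNReal.toReal_one, one_mul]
  rw [ENNReal.toReal_ofReal (by positivity), show ((6 : ℕ) : ℝ) / 2 + 1 = (3 : ℕ) + 1 by norm_num,
    Real.Gamma_nat_eq_factorial, show √π ^ 6 = (√π ^ 2) ^ 3 by ring, Real.sq_sqrt pi_pos.le]
  norm_num [Nat.factorial]
  ring

/-! ### Stationary phase on `ℝ³ × ℝ³` -/

section StationaryPhase

open Set

/-- The amplitude of the oscillatory integral in the coordinates given by `chart u`. -/
def chartAmp (g : SchwartzMap (V3 × V3) ℂ) (u : V3) (Y : V3 × V3) : ℂ :=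
  ((stretch Y.1 * stretch Y.2 : ℝ) : ℂ) * g (chart u Y.1, chart u Y.2)

/-- The weight controlling `chartAmp`. -/
def chartWeight (u : V3) (Y : V3 × V3) : ℝ :=
  stretch Y.1 * stretch Y.2 * ((bracket (chart u Y.1) * bracket (chart u Y.2)) ^ 3)⁻¹

lemma integrable_chartWeight (u : V3) : Integrable (chartWeight u) ∧
    ∫ Y, chartWeight u Y = (∫ p : V3, (bracket p ^ 4)⁻¹) ^ 2 := by
  obtain ⟨h1, h2⟩ := integrable_stretch_mul_bracket_chart u
  have heq : chartWeight u = fun Y : V3 × V3 => (stretch Y.1 * (bracket (chart u Y.1) ^ 3)⁻¹) *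
      (stretch Y.2 * (bracket (chart u Y.2) ^ 3)⁻¹) := by
    ext Y
    rw [chartWeight, mul_pow, mul_inv]
    ring
  rw [heq]
  refine ⟨h1.mul_prod h1, ?_⟩
  rw [Measure.volume_eq_prod, integral_prod_mul (fun y : V3 => stretch y * (bracket (chart u y) ^ 3)⁻¹)
    (fun y : V3 => stretch y * (bracket (chart u y) ^ 3)⁻¹), h2, sq]

lemma continuous_chartAmp (g : SchwartzMap (V3 × V3) ℂ) (u : V3) : Continuous (chartAmp g u) := by
  have h1 := continuous_stretch
  have h2 := continuous_chart u
  have h3 := g.continuous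
  unfold chartAmp
  fun_prop

lemma exists_norm_chartAmp_le (g : SchwartzMap (V3 × V3) ℂ) :
    ∃ C, ∀ u Y, ‖chartAmp g u Y‖ ≤ C * chartWeight u Y := by
  obtain ⟨C, hC⟩ := g.exists_norm_le_bracket 3
  refine ⟨C, fun u Y => ?_⟩
  have h0 : 0 ≤ stretch Y.1 * stretch Y.2 := mul_nonneg (stretch_pos _).le (stretch_pos _).le
  rw [chartAmp, norm_mul, Complex.norm_real, Real.norm_of_nonneg h0, chartWeight, mul_left_comm]
  exact mul_le_mul_of_nonneg_left (hC _ _) h0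

lemma integrable_chartAmp_mul_phase (g : SchwartzMap (V3 × V3) ℂ) (u : V3) (μ : ℝ) :
    Integrable (fun Y : V3 × V3 =>
      chartAmp g u Y * cexp (-(I * μ * (‖Y.1‖ ^ 2 + ‖Y.2‖ ^ 2) / 2))) := by
  obtain ⟨C, hC⟩ := exists_norm_chartAmp_le g
  refine ((integrable_chartWeight u).1.const_mul C).mono' ?_ (.of_forall fun Y => ?_)
  · have := continuous_chartAmp g u
    exact Continuous.aestronglyMeasurable (by fun_prop)
  · have : ‖cexp (-(I * μ * (‖Y.1‖ ^ 2 + ‖Y.2‖ ^ 2) / 2))‖ = 1 := by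
      rw [show -(I * μ * (‖Y.1‖ ^ 2 + ‖Y.2‖ ^ 2) / 2) =
        ((-(μ * (‖Y.1‖ ^ 2 + ‖Y.2‖ ^ 2) / 2) : ℝ) : ℂ) * I by push_cast; ring]
      exact Complex.norm_exp_ofReal_mul_I _
    rw [norm_mul, this, mul_one]
    exact hC u Y

lemma integral_even_part {E : Type*} [AddCommGroup E] [MeasurableSpace E] [MeasurableNeg E]
    (ν : Measure E) [ν.IsNegInvariant] {F : Type*} [NormedAddCommGroup F] [NormedSpace ℝ F]
    {H : E → F} (hH : Integrable H ν) :
    Integrable (fun Y => H Y + H (-Y)) ν ∧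
      ∫ Y, (H Y + H (-Y)) ∂ν = (2 : ℝ) • ∫ Y, H Y ∂ν := by
  have h : Integrable (fun Y => H (-Y)) ν := hH.comp_neg
  refine ⟨hH.add h, ?_⟩
  rw [integral_add hH h, integral_neg_eq_self, two_smul]

/-- The stationary phase expansion with a remainder uniform in the boost. -/
lemma exists_stationary_phase (g : SchwartzMap (V3 × V3) ℂ) :
    ∃ C, 0 ≤ C ∧ ∀ (u : V3) (μ : ℝ), μ ≠ 0 →
      ‖(∫ Y : V3 × V3, chartAmp g u Y * cexp (-(I * μ * (‖Y.1‖ ^ 2 + ‖Y.2‖ ^ 2) / 2))) -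
        (2 * π) ^ 3 * g (u, u) / (I * μ) ^ 3‖ ≤ C * (bracket u ^ 4)⁻¹ * (|μ| ^ 4)⁻¹ := by
  obtain ⟨C, hC0, hC⟩ := RayPoint.exists_ray_estimate g
  set K := ∫ p : V3, (bracket p ^ 4)⁻¹
  refine ⟨C * (π ^ 3 + 2 * K ^ 2), by positivity, fun u μ hμ => ?_⟩
  have mp := WithLp.volume_preserving_ofLp V3 V3
  have me : MeasurableEmbedding (WithLp.ofLp : WithLp 2 (V3 × V3) → V3 × V3) :=
    (WithLp.homeomorphProd 2 V3 V3).measurableEmbedding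
  have hdim : Module.finrank ℝ (WithLp 2 (V3 × V3)) - 1 = 5 := by
    rw [LinearEquiv.finrank_eq (WithLp.linearEquiv 2 ℝ (V3 × V3))]
    simp
  set H₀ : V3 × V3 → ℂ := fun Y =>
    chartAmp g u Y * cexp (-(I * μ * (‖Y.1‖ ^ 2 + ‖Y.2‖ ^ 2) / 2)) with hH₀
  have hH : Integrable (fun Y : WithLp 2 (V3 × V3) => H₀ Y.ofLp) :=
    (mp.integrable_comp_emb me).2 (integrable_chartAmp_mul_phase g u μ)
  have hT : Integrable (fun Y : WithLp 2 (V3 × V3) => chartWeight u Y.ofLp) :=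
    (mp.integrable_comp_emb me).2 (integrable_chartWeight u).1
  have hHi : ∫ Y : WithLp 2 (V3 × V3), H₀ Y.ofLp = ∫ Y, H₀ Y := mp.integral_comp me _
  have hTi : ∫ Y : WithLp 2 (V3 × V3), chartWeight u Y.ofLp = K ^ 2 :=
    (mp.integral_comp me _).trans (integrable_chartWeight u).2
  have : ProperSpace (WithLp 2 (V3 × V3)) := FiniteDimensional.proper ℝ _
  obtain ⟨hHe, hHei⟩ := integral_even_part volume hH
  obtain ⟨hTe, hTei⟩ := integral_even_part volume hT
  obtain ⟨-, hHp, hHpi⟩ := integral_polar volume hHe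
  obtain ⟨hTa, hTp, hTpi⟩ := integral_polar volume hTe
  rw [hdim] at hTa hTp hTpi hHp hHpi
  set S := (volume : Measure (WithLp 2 (V3 × V3))).toSphere with hS
  have hd : ∀ (θ : Metric.sphere (0 : WithLp 2 (V3 × V3)) 1) (i : Fin 2),
      ‖(![(θ : WithLp 2 (V3 × V3)).fst, (θ : WithLp 2 (V3 × V3)).snd] : Fin 2 → V3) i‖ ≤ 1 := by
    intro θ i
    have h1 : ‖(θ : WithLp 2 (V3 × V3))‖ = 1 := by simp
    fin_cases i
    · exact (WithLp.norm_fst_le V3 (θ : WithLp 2 (V3 × V3))).trans h1.le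
    · exact (WithLp.norm_snd_le V3 (θ : WithLp 2 (V3 × V3))).trans h1.le
  have hd1 : ∀ θ : Metric.sphere (0 : WithLp 2 (V3 × V3)) 1,
      ‖(θ : WithLp 2 (V3 × V3)).fst‖ ^ 2 + ‖(θ : WithLp 2 (V3 × V3)).snd‖ ^ 2 = 1 := by
    intro θ
    have h1 : ‖(θ : WithLp 2 (V3 × V3))‖ = 1 := by simp
    rw [← WithLp.prod_norm_sq_eq_of_L2, h1, one_pow]
  have hwt : ∀ (θ : Metric.sphere (0 : WithLp 2 (V3 × V3)) 1) (r : ℝ),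
      r ^ 5 • (chartWeight u (r • (θ : WithLp 2 (V3 × V3))).ofLp +
        chartWeight u (-(r • (θ : WithLp 2 (V3 × V3)))).ofLp) =
      r ^ 5 * RayPoint.evenWeight u (hd θ) 3 r := by
    intro θ r
    rw [← neg_smul]
    rfl
  have hHt : ∀ (θ : Metric.sphere (0 : WithLp 2 (V3 × V3)) 1) (r : ℝ),
      r ^ 5 • (H₀ (r • (θ : WithLp 2 (V3 × V3))).ofLp +
        H₀ (-(r • (θ : WithLp 2 (V3 × V3)))).ofLp) =
      2 * ((r : ℂ) ^ 5 * ((RayPoint.amp g ⟨u, _, r, hd θ⟩ + RayPoint.amp g ⟨u, _, -r, hd θ⟩) / 2) *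
        cexp (-(I * μ * r ^ 2 / 2))) := by
    intro θ r
    have hn : ∀ t : ℝ, ((‖(t • (θ : WithLp 2 (V3 × V3))).ofLp.1‖ : ℂ) ^ 2 +
        (‖(t • (θ : WithLp 2 (V3 × V3))).ofLp.2‖ : ℂ) ^ 2) = (t : ℂ) ^ 2 := by
      intro t
      have : ‖(t • (θ : WithLp 2 (V3 × V3))).fst‖ ^ 2 +
          ‖(t • (θ : WithLp 2 (V3 × V3))).snd‖ ^ 2 = t ^ 2 := by
        rw [WithLp.smul_fst, WithLp.smul_snd, norm_smul, norm_smul, mul_pow, mul_pow, ← mul_add,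
          hd1 θ, mul_one, Real.norm_eq_abs, sq_abs]
      exact_mod_cast this
    have ha : ∀ t : ℝ, chartAmp g u (t • (θ : WithLp 2 (V3 × V3))).ofLp =
        RayPoint.amp g ⟨u, _, t, hd θ⟩ := fun t => rfl
    rw [← neg_smul, hH₀]
    simp only [hn, ha]
    rw [Complex.real_smul]
    push_cast
    ring_nf
  simp only [hwt] at hTa hTp hTpi
  simp only [hHt, integral_const_mul] at hHp hHpi
  set J : Metric.sphere (0 : WithLp 2 (V3 × V3)) 1 → ℂ := fun θ => ∫ r in Ioi (0 : ℝ),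
    (r : ℂ) ^ 5 * ((RayPoint.amp g ⟨u, _, r, hd θ⟩ + RayPoint.amp g ⟨u, _, -r, hd θ⟩) / 2) *
        cexp (-(I * μ * r ^ 2 / 2)) with hJ
  set T : Metric.sphere (0 : WithLp 2 (V3 × V3)) 1 → ℝ := fun θ => ∫ r in Ioi (0 : ℝ),
    r ^ 5 * RayPoint.evenWeight u (hd θ) 3 r with hTdef
  have hJint : Integrable J S := by
    have := hHp.const_mul (1 / 2 : ℂ)
    refine this.congr (.of_forall fun θ => ?_)
    simp only [hJ]
    ring
  have hJeq : ∫ θ, J θ ∂S = ∫ Y, H₀ Y := by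
    rw [← hHi]
    rw [hHei, Complex.real_smul] at hHpi
    have h2 : ((2 : ℝ) : ℂ) ≠ 0 := by norm_num
    refine mul_left_cancel₀ h2 ?_
    rw [← hHpi]
    push_cast
    rfl
  have hTeq : ∫ θ, T θ ∂S = 2 * K ^ 2 := by
    rw [← hTi]
    exact hTpi.trans hTei
  have hSu : S.real univ = π ^ 3 := toSphere_real_univ_prod
  have hconst : (∫ _θ : Metric.sphere (0 : WithLp 2 (V3 × V3)) 1, 8 * g (u, u) / (I * μ) ^ 3 ∂S) =
      (2 * π) ^ 3 * g (u, u) / (I * μ) ^ 3 := by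
    rw [integral_const, hSu, Complex.real_smul]
    push_cast
    ring
  rw [← hJeq, ← hconst, ← integral_sub hJint (integrable_const _)]
  refine (norm_integral_le_of_norm_le (g := fun θ => C * (bracket u ^ 4)⁻¹ * (|μ| ^ 4)⁻¹ * (1 + T θ))
    (((integrable_const _).add hTp).const_mul _) ?_).trans_eq ?_
  · filter_upwards [hTa] with θ hθ
    exact hC u _ (hd θ) (hd1 θ) μ hμ hθ
  · rw [integral_const_mul, integral_add (integrable_const _) hTp, integral_const, hSu, hTeq]
    simp only [smul_eq_mul]
    ring

end StationaryPhase

/-! ### The timelike region -/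

section Timelike

lemma ωm_smul {m : ℝ} (hm : 0 < m) (p : V3) : ωm m (m • p) = m * bracket p := by
  rw [ωm, bracket, norm_smul, Real.norm_of_nonneg hm.le,
    show m ^ 2 + (m * ‖p‖) ^ 2 = m ^ 2 * (1 + ‖p‖ ^ 2) by ring, Real.sqrt_mul (sq_nonneg m),
    Real.sqrt_sq hm.le]

lemma integral_eq_integral_chart {m : ℝ} (hm : 0 < m) (u : V3) (G : V3 → ℂ) :
    ∫ p, G p = ∫ y, (m ^ 3 * (stretch y * bracket (chart u y))) • G (m • chart u y) := by
  have h := integral_comp_chart u fun p => G (m • p)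
  rw [Measure.integral_comp_smul] at h
  simp only [mul_smul (m ^ 3)]
  rw [integral_smul, h, smul_smul]
  have : |(m ^ Module.finrank ℝ V3)⁻¹| = (m ^ 3)⁻¹ := by
    rw [abs_of_pos (by positivity)]
    simp
  rw [this, mul_inv_cancel₀ (by positivity), one_smul]

lemma phase_chart (u y : V3) :
    bracket (chart u y) * bracket u - ⟪chart u y, u⟫_ℝ = 1 + ‖y‖ ^ 2 / 2 := by
  rw [chart, mul_comm, bracket_mul_bracket_boost_sub, bracket_stretch_smul]

lemma Iplus_eq_chart {m : ℝ} (hm : 0 < m) {f g : SchwartzMap (V3 × V3) ℂ}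
    (hg : ∀ p q, g (p, q) = f (m • p, m • q)) (lam : ℝ) (u : V3) :
    Iplus m f (lam * bracket u) (lam • u) = ((2 * π : ℂ) ^ 3)⁻¹ * (m ^ 6 * cexp (-I * (2 * m * lam)) *
      ∫ Y : V3 × V3, chartAmp g u Y *
        cexp (-(I * ((m * lam : ℝ) : ℂ) * (‖Y.1‖ ^ 2 + ‖Y.2‖ ^ 2) / 2))) := by
  have hInt := integrable_chartAmp_mul_phase g u (m * lam)
  rw [Measure.volume_eq_prod] at hInt
  rw [Iplus, Measure.volume_eq_prod, integral_prod _ hInt]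
  rw [show ((((2 * π) ^ 3)⁻¹ : ℝ) : ℂ) = ((2 * π : ℂ) ^ 3)⁻¹ by push_cast; rfl]
  congr 1
  rw [integral_eq_integral_chart hm u, ← integral_const_mul]
  refine integral_congr_ae (.of_forall fun y => ?_)
  beta_reduce
  rw [integral_eq_integral_chart hm u, ← integral_smul, ← integral_const_mul]
  refine integral_congr_ae (.of_forall fun z => ?_)
  beta_reduce
  have hy := bracket_pos (chart u y)
  have hz := bracket_pos (chart u z)
  have hphase : (ωm m (m • chart u y) + ωm m (m • chart u z)) * (lam * bracket u) -
      (⟪m • chart u y, lam • u⟫_ℝ + ⟪m • chart u z, lam • u⟫_ℝ) =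
      2 * m * lam + m * lam * (‖y‖ ^ 2 + ‖z‖ ^ 2) / 2 := by
    rw [ωm_smul hm, ωm_smul hm]
    simp only [real_inner_smul_left, real_inner_smul_right]
    linear_combination m * lam * phase_chart u y + m * lam * phase_chart u z
  have hexp : cexp (-I * ((2 * m * lam + m * lam * (‖y‖ ^ 2 + ‖z‖ ^ 2) / 2 : ℝ) : ℂ)) =
      cexp (-I * (2 * m * lam)) * cexp (-(I * (m * lam) * (‖y‖ ^ 2 + ‖z‖ ^ 2) / 2)) := by
    rw [← Complex.exp_add]
    push_cast
    ring_nf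
  have hjac : (m ^ 3 * (stretch y * bracket (chart u y))) *
      ((m ^ 3 * (stretch z * bracket (chart u z))) *
        (m ^ 2 / (ωm m (m • chart u y) * ωm m (m • chart u z)))) =
      m ^ 6 * (stretch y * stretch z) := by
    rw [ωm_smul hm, ωm_smul hm]
    field_simp
  rw [hphase, hexp, chartAmp, hg, Complex.real_smul, Complex.real_smul]
  have hjac' := congrArg (fun t : ℝ => (t : ℂ)) hjac
  simp only [Complex.ofReal_mul, Complex.ofReal_pow] at hjac' ⊢
  linear_combination f (m • chart u y, m • chart u z) * cexp (-I * (2 * m * lam)) *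
    cexp (-(I * (m * lam) * (‖y‖ ^ 2 + ‖z‖ ^ 2) / 2)) * hjac'

lemma exists_schwartz_comp_smul {m : ℝ} (hm : 0 < m) (f : SchwartzMap (V3 × V3) ℂ) :
    ∃ g : SchwartzMap (V3 × V3) ℂ, ∀ p q, g (p, q) = f (m • p, m • q) :=
  ⟨SchwartzMap.compCLMOfContinuousLinearEquiv ℝ
    (ContinuousLinearEquiv.smulLeft (R₁ := ℝ) (M₁ := V3 × V3) (Units.mk0 m hm.ne')) f,
    fun _ _ => rfl⟩

theorem Iplus_timelike {m : ℝ} (hm : 0 < m) (f : SchwartzMap (V3 × V3) ℂ) :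
    ∃ C : ℝ, ∀ (x0 : ℝ) (xv : V3), 1 ≤ x0 ^ 2 - ‖xv‖ ^ 2 →
      ∀ lam : ℝ, lam = Real.sign x0 * Real.sqrt (x0 ^ 2 - ‖xv‖ ^ 2) →
      ∀ uv : V3, uv = lam⁻¹ • xv →
        ‖Iplus m f x0 xv -
          Complex.I * ((Real.sign lam : ℝ) : ℂ) *
            Complex.exp (-Complex.I * ((2 * m * lam : ℝ) : ℂ)) *
            (((m / |lam|) ^ 3 : ℝ) : ℂ) * f (m • uv, m • uv)‖ ≤
          C * (1 + Real.sqrt (x0 ^ 2 + ‖xv‖ ^ 2)) ^ (-(4 : ℝ)) := by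
  obtain ⟨g, hg⟩ := exists_schwartz_comp_smul hm f
  obtain ⟨C, hC0, hC⟩ := exists_stationary_phase g
  refine ⟨((2 * π) ^ 3)⁻¹ * m ^ 2 * C * 81, fun x0 xv hx lam hlam u hu => ?_⟩
  set D := √(x0 ^ 2 - ‖xv‖ ^ 2) with hD
  have hD1 : 1 ≤ D := Real.one_le_sqrt.2 hx
  have hDsq : D ^ 2 = x0 ^ 2 - ‖xv‖ ^ 2 := Real.sq_sqrt (by linarith)
  have hx0 : x0 ≠ 0 := by
    rintro rfl
    nlinarith [norm_nonneg xv]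
  have hsign : Real.sign x0 * |x0| = x0 ∧ |Real.sign x0| = 1 ∧ Real.sign x0 ^ 2 = 1 := by
    rcases lt_or_gt_of_ne hx0 with h | h
    · simp [Real.sign_of_neg h, abs_of_neg h]
    · simp [Real.sign_of_pos h, abs_of_pos h]
  have hlamabs : |lam| = D := by
    rw [hlam, abs_mul, hsign.2.1, one_mul, abs_of_pos (by linarith)]
  have hlam0 : lam ≠ 0 := by
    rw [← abs_pos, hlamabs]
    linarith
  have hlamsq : lam ^ 2 = D ^ 2 := by rw [← hlamabs, sq_abs]
  have hxv : xv = lam • u := by rw [hu, smul_smul, mul_inv_cancel₀ hlam0, one_smul]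
  have hnx : ‖xv‖ = D * ‖u‖ := by rw [hxv, norm_smul, Real.norm_eq_abs, hlamabs]
  have hb : D * bracket u = |x0| := by
    rw [← Real.sqrt_sq_eq_abs, bracket, hD, ← Real.sqrt_mul (by linarith)]
    congr 1
    rw [← hDsq, mul_add, ← mul_pow, ← hnx, hDsq]
    ring
  have hx0' : x0 = lam * bracket u := by rw [hlam, mul_assoc, hb, hsign.1]
  have hR : 1 + √(x0 ^ 2 + ‖xv‖ ^ 2) ≤ 3 * (D * bracket u) := by
    have h1 : √(x0 ^ 2 + ‖xv‖ ^ 2) ≤ 2 * |x0| := by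
      refine Real.sqrt_le_iff.2 ⟨by positivity, ?_⟩
      rw [mul_pow, sq_abs]
      nlinarith [norm_nonneg xv]
    have h2 : 1 ≤ D * bracket u := one_le_mul_of_one_le_of_one_le hD1 (one_le_bracket u)
    rw [hb] at h2 ⊢
    linarith
  have hR0 : 0 < 1 + √(x0 ^ 2 + ‖xv‖ ^ 2) := by positivity
  have hest := hC u (m * lam) (mul_ne_zero hm.ne' hlam0)
  have hmain : I * ((Real.sign lam : ℝ) : ℂ) * cexp (-I * ((2 * m * lam : ℝ) : ℂ)) *
      (((m / |lam|) ^ 3 : ℝ) : ℂ) * f (m • u, m • u) =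
      ((2 * π : ℂ) ^ 3)⁻¹ * (m ^ 6 * cexp (-I * (2 * m * lam)) *
        ((2 * π) ^ 3 * g (u, u) / (I * ((m * lam : ℝ) : ℂ)) ^ 3)) := by
    have hs : Real.sign lam * (m / |lam|) ^ 3 = m ^ 3 / lam ^ 3 := by
      rcases lt_or_gt_of_ne hlam0 with h | h
      · rw [Real.sign_of_neg h, abs_of_neg h]
        field_simp
      · rw [Real.sign_of_pos h, abs_of_pos h]
        field_simp
    have hs' := congrArg (fun t : ℝ => (t : ℂ)) hs
    have hm' : (m : ℂ) ≠ 0 := by exact_mod_cast hm.ne'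
    have hl' : (lam : ℂ) ≠ 0 := by exact_mod_cast hlam0
    have hpi : (π : ℂ) ≠ 0 := by exact_mod_cast pi_ne_zero
    rw [hg]
    push_cast at hs' ⊢
    have hI : I ^ 3 = -I := by rw [pow_succ, I_sq]; ring
    rw [show ((2 * π : ℂ) ^ 3)⁻¹ * (m ^ 6 * cexp (-I * (2 * m * lam)) *
        ((2 * π) ^ 3 * f (m • u, m • u) / (I * (m * lam)) ^ 3)) =
        I * (m ^ 3 / lam ^ 3) * cexp (-I * (2 * m * lam)) * f (m • u, m • u) by
      rw [mul_pow, mul_pow, mul_pow, hI]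
      field_simp
      linear_combination -f (m • u, m • u) * I_sq]
    linear_combination I * cexp (-I * (2 * m * lam)) * f (m • u, m • u) * hs'
  have hexp : ‖cexp (-I * (2 * m * lam))‖ = 1 := by
    rw [show -I * (2 * m * lam : ℂ) = ((-(2 * m * lam) : ℝ) : ℂ) * I by push_cast; ring]
    exact Complex.norm_exp_ofReal_mul_I _
  rw [hmain]
  nth_rw 1 [hx0']
  nth_rw 1 [hxv]
  rw [Iplus_eq_chart hm hg, ← mul_sub, ← mul_sub, norm_mul, norm_mul, norm_mul, hexp]
  have hpi : ‖((2 * π : ℂ) ^ 3)⁻¹‖ = ((2 * π) ^ 3)⁻¹ := by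
    rw [norm_inv, norm_pow, norm_mul, Complex.norm_real, Real.norm_of_nonneg pi_pos.le]
    simp
  have hmn : ‖(m : ℂ) ^ 6‖ = m ^ 6 := by
    rw [norm_pow, Complex.norm_real, Real.norm_of_nonneg hm.le]
  rw [hpi, hmn, mul_one]
  have hp : (0 : ℝ) < ((2 * π) ^ 3)⁻¹ := by positivity
  have hbu := bracket_pos u
  have hD0 : 0 < D := by linarith
  calc ((2 * π) ^ 3)⁻¹ * (m ^ 6 * _)
      ≤ ((2 * π) ^ 3)⁻¹ * (m ^ 6 * (C * (bracket u ^ 4)⁻¹ * (|m * lam| ^ 4)⁻¹)) := by gcongr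
    _ = ((2 * π) ^ 3)⁻¹ * m ^ 2 * C * 81 * ((3 * (D * bracket u)) ^ 4)⁻¹ := by
        rw [abs_mul, hlamabs, abs_of_pos hm]
        field_simp
        norm_num
    _ ≤ ((2 * π) ^ 3)⁻¹ * m ^ 2 * C * 81 * ((1 + √(x0 ^ 2 + ‖xv‖ ^ 2)) ^ 4)⁻¹ := by gcongr
    _ = _ := by
        rw [Real.rpow_neg hR0.le]
        norm_cast

end Timelike

/-! ### The complement of the timelike region -/

section Spacelike

/-- The parameters `x = (x₀, ρ e)` of the phase, in a region where `|x₀|` exceeds `ρ` by at most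
`k`. -/
structure PhaseParam (k : ℝ) where
  /-- time component -/
  x0 : ℝ
  /-- length of the space component -/
  ρ : ℝ
  /-- direction of the space component -/
  e : V3
  norm_e : ‖e‖ = 1
  ρ_nonneg : 0 ≤ ρ
  abs_x0_le : |x0| ≤ ρ + k

namespace PhaseParam

variable {k : ℝ}

/-- The size of the parameter. -/
def size (a : PhaseParam k) : ℝ := 1 + |a.x0| + a.ρ

lemma one_le_size (a : PhaseParam k) : 1 ≤ a.size := by
  have := abs_nonneg a.x0
  have := a.ρ_nonneg
  rw [size]
  linarith

lemma size_pos (a : PhaseParam k) : 0 < a.size := zero_lt_one.trans_le a.one_le_size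

end PhaseParam

/-- Phase parameters together with a pair of momenta. -/
abbrev PhasePoint (k : ℝ) := PhaseParam k × (V3 × V3)

namespace PhasePoint

variable {k : ℝ}

/-- Translation of the first momentum along the direction of the parameter. -/
def shift (x : PhasePoint k) (t : ℝ) : PhasePoint k := (x.1, x.2 + t • (x.1.e, (0 : V3)))

lemma shift_zero (x : PhasePoint k) : x.shift 0 = x := by simp [shift]

lemma shift_p (x : PhasePoint k) (t : ℝ) : (x.shift t).2.1 = x.2.1 + t • x.1.e := rfl

lemma shift_q (x : PhasePoint k) (t : ℝ) : (x.shift t).2.2 = x.2.2 := by simp [shift]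

/-- The inverse of the first energy. -/
def η (x : PhasePoint k) : ℝ := (bracket x.2.1)⁻¹

/-- The velocity of the first momentum in the direction of the parameter. -/
def κ (x : PhasePoint k) : ℝ := ⟪x.2.1, x.1.e⟫_ℝ * x.η

/-- The derivative of the phase. -/
def ψ (x : PhasePoint k) : ℝ := x.1.x0 * x.κ + -x.1.ρ

/-- The regularised inverse square of the derivative of the phase. -/
def cutoff (x : PhasePoint k) : ℝ := (1 + x.ψ ^ 2)⁻¹

/-- The product of the energies. -/
def W (x : PhasePoint k) : ℝ := bracket x.2.1 * bracket x.2.2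

lemma one_le_W (x : PhasePoint k) : 1 ≤ x.W :=
  one_le_mul_of_one_le_of_one_le (one_le_bracket _) (one_le_bracket _)

lemma W_pos (x : PhasePoint k) : 0 < x.W := zero_lt_one.trans_le x.one_le_W

lemma bracket_le_W (x : PhasePoint k) : bracket x.2.1 ≤ x.W :=
  le_mul_of_one_le_right (bracket_pos _).le (one_le_bracket _)

lemma η_pos (x : PhasePoint k) : 0 < x.η := inv_pos.2 (bracket_pos _)

lemma η_le_one (x : PhasePoint k) : x.η ≤ 1 := inv_le_one_of_one_le₀ (one_le_bracket _)

lemma κ_sq_le (x : PhasePoint k) : x.κ ^ 2 ≤ 1 - x.η ^ 2 := by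
  have hb := bracket_pos x.2.1
  have h1 : ⟪x.2.1, x.1.e⟫_ℝ ^ 2 ≤ ‖x.2.1‖ ^ 2 := by
    rw [sq_le_sq, abs_norm]
    simpa [x.1.norm_e] using abs_real_inner_le_norm x.2.1 x.1.e
  have h2 : x.η ^ 2 * bracket x.2.1 ^ 2 = 1 := by
    rw [η, ← mul_pow, inv_mul_cancel₀ hb.ne', one_pow]
  have h3 := bracket_sq x.2.1
  rw [κ, mul_pow]
  nlinarith [mul_le_mul_of_nonneg_right h1 (sq_nonneg x.η)]

lemma abs_κ_le_one (x : PhasePoint k) : |x.κ| ≤ 1 := by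
  rw [← sq_le_one_iff_abs_le_one]
  linarith [x.κ_sq_le, sq_nonneg x.η]

lemma hasDerivAt_bracket (x : PhasePoint k) :
    HasDerivAt (fun t => bracket (x.shift t).2.1) x.κ 0 := by
  have h1 : HasDerivAt (fun t : ℝ => x.2.1 + t • x.1.e) x.1.e 0 := by
    simpa using ((hasDerivAt_id (0 : ℝ)).smul_const x.1.e).const_add x.2.1
  have h2 : HasFDerivAt bracket ((bracket x.2.1)⁻¹ • innerSL ℝ x.2.1)
      (x.2.1 + (0 : ℝ) • x.1.e) := by
    simpa using hasFDerivAt_bracket x.2.1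
  refine (h2.comp_hasDerivAt (0 : ℝ) h1).congr_deriv ?_
  simp [κ, η, mul_comm]

lemma hasDerivAt_η (x : PhasePoint k) :
    HasDerivAt (fun t => (x.shift t).η) (-1 * (x.κ * (x.η * x.η))) 0 := by
  refine (x.hasDerivAt_bracket.inv (bracket_pos _).ne').congr_deriv ?_
  rw [shift_zero, η]
  field_simp

lemma hasDerivAt_κ (x : PhasePoint k) :
    HasDerivAt (fun t => (x.shift t).κ) (x.η + -1 * (x.κ * (x.κ * x.η))) 0 := by
  have h1 : HasDerivAt (fun t : ℝ => ⟪(x.shift t).2.1, (x.shift t).1.e⟫_ℝ) 1 0 := by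
    have h : (fun t : ℝ => ⟪(x.shift t).2.1, (x.shift t).1.e⟫_ℝ) =
        fun t => ⟪x.2.1, x.1.e⟫_ℝ + t := by
      ext t
      rw [shift_p]
      simp [shift, inner_add_left, inner_smul_left, x.1.norm_e]
    rw [h]
    simpa using (hasDerivAt_id (0 : ℝ)).const_add ⟪x.2.1, x.1.e⟫_ℝ
  refine (h1.mul x.hasDerivAt_η).congr_deriv ?_
  rw [shift_zero, κ]
  ring

lemma hasDerivAt_ψ (x : PhasePoint k) :
    HasDerivAt (fun t => (x.shift t).ψ) (x.1.x0 * (x.η + -1 * (x.κ * (x.κ * x.η)))) 0 :=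
  (x.hasDerivAt_κ.const_mul x.1.x0).add_const (-x.1.ρ)

lemma hasDerivAt_cutoff (x : PhasePoint k) :
    HasDerivAt (fun t => (x.shift t).cutoff)
      (-2 * ((x.ψ * (x.1.x0 * (x.η + -1 * (x.κ * (x.κ * x.η))))) * (x.cutoff * x.cutoff))) 0 := by
  have h0 : 1 + (x.shift 0).ψ ^ 2 ≠ 0 := by positivity
  refine (((x.hasDerivAt_ψ.fun_pow 2).const_add 1).fun_inv h0).congr_deriv ?_
  rw [shift_zero] at h0 ⊢
  rw [cutoff]
  simp only [Nat.cast_ofNat, Nat.add_one_sub_one, pow_one]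
  field_simp

lemma size_le (hk : 0 ≤ k) (x : PhasePoint k) :
    x.1.size ≤ 5 * (1 + k) * (bracket x.2.1 ^ 2 * (1 + |x.ψ|)) := by
  have hb := bracket_pos x.2.1
  have hb1 : 1 ≤ bracket x.2.1 ^ 2 := one_le_pow₀ (one_le_bracket _)
  have hκ0 := abs_nonneg x.κ
  have hκ1 := x.abs_κ_le_one
  have hρ := x.1.ρ_nonneg
  have hx0 := x.1.abs_x0_le
  have hψ : x.1.ρ - |x.1.x0| * |x.κ| ≤ |x.ψ| := by
    rw [← abs_mul]
    have h1 := neg_abs_le x.ψ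
    have h2 := le_abs_self (x.1.x0 * x.κ)
    rw [ψ] at h1 ⊢
    linarith
  have hη : x.η ^ 2 * bracket x.2.1 ^ 2 = 1 := by
    rw [η, ← mul_pow, inv_mul_cancel₀ hb.ne', one_pow]
  have hgap : x.η ^ 2 ≤ 2 * (1 - |x.κ|) := by
    have := x.κ_sq_le
    rw [← sq_abs] at this
    nlinarith
  have h1 : x.1.ρ * (1 - |x.κ|) ≤ |x.ψ| + k := by nlinarith
  have h2 : x.1.ρ ≤ 2 * bracket x.2.1 ^ 2 * (|x.ψ| + k) := by
    have h3 := mul_le_mul_of_nonneg_left h1 (sq_nonneg (bracket x.2.1))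
    have h4 := mul_le_mul_of_nonneg_left hgap (mul_nonneg hρ (sq_nonneg (bracket x.2.1)))
    nlinarith
  have hψ0 := abs_nonneg x.ψ
  rw [PhaseParam.size]
  nlinarith [mul_nonneg hk hψ0, mul_nonneg (sub_nonneg.2 hb1) (mul_nonneg hk hψ0),
    mul_nonneg (sub_nonneg.2 hb1) hk, mul_nonneg (sub_nonneg.2 hb1) hψ0]

lemma cutoff_le (hk : 0 ≤ k) (x : PhasePoint k) :
    x.cutoff ≤ 50 * (1 + k) ^ 2 * (x.W ^ 4 * (x.1.size ^ 2)⁻¹) := by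
  have h1 : x.1.size ^ 2 ≤ (5 * (1 + k) * (bracket x.2.1 ^ 2 * (1 + |x.ψ|))) ^ 2 :=
    pow_le_pow_left₀ x.1.size_pos.le (x.size_le hk) 2
  have h2 : (1 + |x.ψ|) ^ 2 ≤ 2 * (1 + x.ψ ^ 2) := by
    rw [← sq_abs x.ψ]
    nlinarith [sq_nonneg (1 - |x.ψ|)]
  have h3 : bracket x.2.1 ^ 4 ≤ x.W ^ 4 := pow_le_pow_left₀ (bracket_pos _).le x.bracket_le_W 4
  have h4 : x.1.size ^ 2 ≤ 50 * (1 + k) ^ 2 * x.W ^ 4 * (1 + x.ψ ^ 2) :=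
    calc x.1.size ^ 2 ≤ 25 * (1 + k) ^ 2 * bracket x.2.1 ^ 4 * (1 + |x.ψ|) ^ 2 :=
          h1.trans_eq (by ring)
      _ ≤ 25 * (1 + k) ^ 2 * x.W ^ 4 * (2 * (1 + x.ψ ^ 2)) := by
          gcongr
      _ = _ := by ring
  have hs := x.1.size_pos
  rw [cutoff, ← mul_assoc, ← div_eq_mul_inv, le_div_iff₀ (by positivity),
    inv_mul_le_iff₀ (by positivity)]
  linarith

/-- Symbols along the translation of the first momentum. -/
abbrev IsShiftSymbol {A : Type*} [NormedRing A] [NormedAlgebra ℝ A] (n : ℕ) (w : PhasePoint k → ℝ)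
    (f : PhasePoint k → A) : Prop := IsSymbol shift (fun _ => 1) n w f

variable {A : Type*} [NormedRing A] [NormedAlgebra ℝ A] {n : ℕ} {w w₁ w₂ : PhasePoint k → ℝ}
  {f g : PhasePoint k → A}

lemma IsShiftSymbol.mul (hw₁ : ∀ x, 0 ≤ w₁ x) (hw₂ : ∀ x, 0 ≤ w₂ x) (hf : IsShiftSymbol n w₁ f)
    (hg : IsShiftSymbol n w₂ g) : IsShiftSymbol n (fun x => w₁ x * w₂ x) (fun x => f x * g x) :=
  IsSymbol.mul shift_zero (fun _ => zero_le_one) hw₁ hw₂ hf hg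

lemma IsShiftSymbol.const_mul (hw : ∀ x, 0 ≤ w x) (hf : IsShiftSymbol n w f) (c : A) :
    IsShiftSymbol n w (fun x => c * f x) :=
  IsSymbol.const_mul shift_zero (fun _ => zero_le_one) hw hf c

lemma IsShiftSymbol.of_hasDerivAt {f' : PhasePoint k → A} (hb : ∃ C, ∀ x, ‖f x‖ ≤ C * w x)
    (hd : ∀ x, HasDerivAt (fun t => f (shift x t)) (f' x) 0) (hf' : IsShiftSymbol n w f') :
    IsShiftSymbol (n + 1) w f :=
  IsSymbol.of_hasDerivAt hb hd (hf'.congr_weight fun _ => (mul_one _).symm)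

lemma isShiftSymbol_η_κ (n : ℕ) : IsShiftSymbol n (fun _ => 1) (η (k := k)) ∧
    IsShiftSymbol n (fun _ => 1) (κ (k := k)) := by
  have hη : ∃ C, ∀ x : PhasePoint k, ‖x.η‖ ≤ C * 1 :=
    ⟨1, fun x => by rw [Real.norm_of_nonneg x.η_pos.le, one_mul]; exact x.η_le_one⟩
  have hκ : ∃ C, ∀ x : PhasePoint k, ‖x.κ‖ ≤ C * 1 := ⟨1, fun x => by simpa using x.abs_κ_le_one⟩
  have one : ∀ _ : PhasePoint k, (0 : ℝ) ≤ 1 := fun _ => zero_le_one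
  have mul1 : ∀ {n : ℕ} {f g : PhasePoint k → ℝ}, IsShiftSymbol n (fun _ => 1) f →
      IsShiftSymbol n (fun _ => 1) g → IsShiftSymbol n (fun _ => 1) (fun x => f x * g x) :=
    fun hf hg => (IsShiftSymbol.mul one one hf hg).congr_weight fun _ => one_mul _
  induction n with
  | zero => exact ⟨hη, hκ⟩
  | succ n ih =>
    obtain ⟨h1, h2⟩ := ih
    exact ⟨.of_hasDerivAt hη hasDerivAt_η ((mul1 h2 (mul1 h1 h1)).const_mul one _),
      .of_hasDerivAt hκ hasDerivAt_κ (h1.add ((mul1 h2 (mul1 h2 h1)).const_mul one _))⟩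

lemma isShiftSymbol_x0 (n : ℕ) :
    IsShiftSymbol n (fun x => x.1.size) (fun x : PhasePoint k => x.1.x0) :=
  IsSymbol.of_invariant (fun _ _ => rfl) (fun _ => zero_le_one) (fun x => x.1.size_pos.le)
    ⟨1, fun x => by
      have := x.1.ρ_nonneg
      rw [PhaseParam.size, Real.norm_eq_abs]
      linarith⟩

lemma isShiftSymbol_ψ (n : ℕ) : IsShiftSymbol n (fun x => x.1.size) (ψ (k := k)) := by
  have h1 : IsShiftSymbol n (fun x => x.1.size) (fun x : PhasePoint k => x.1.x0 * x.κ) :=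
    ((isShiftSymbol_x0 n).mul (fun x => x.1.size_pos.le) (fun _ => zero_le_one)
      (isShiftSymbol_η_κ n).2).congr_weight fun x => mul_one _
  refine h1.add (IsSymbol.of_invariant (fun _ _ => rfl) (fun _ => zero_le_one)
    (fun x => x.1.size_pos.le) ⟨1, fun x => ?_⟩)
  rw [norm_neg, Real.norm_of_nonneg x.1.ρ_nonneg, PhaseParam.size]
  linarith [abs_nonneg x.1.x0]

lemma exists_isShiftSymbol_cutoff (hk : 0 ≤ k) (n : ℕ) :
    ∃ M, IsShiftSymbol n (fun x => x.W ^ M * (x.1.size ^ 2)⁻¹) (cutoff (k := k)) := by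
  have hb : ∃ C, ∀ x : PhasePoint k, ‖x.cutoff‖ ≤ C * (x.W ^ 4 * (x.1.size ^ 2)⁻¹) :=
    ⟨50 * (1 + k) ^ 2, fun x => by
      rw [Real.norm_of_nonneg (by rw [cutoff]; positivity)]
      exact x.cutoff_le hk⟩
  have hw : ∀ M, ∀ x : PhasePoint k, 0 ≤ x.W ^ M * (x.1.size ^ 2)⁻¹ := fun M x => by
    have := x.W_pos
    positivity
  have hs : ∀ x : PhasePoint k, 0 ≤ x.1.size := fun x => x.1.size_pos.le
  have one : ∀ _ : PhasePoint k, (0 : ℝ) ≤ 1 := fun _ => zero_le_one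
  induction n with
  | zero => exact ⟨4, hb⟩
  | succ n ih =>
    obtain ⟨M, hM⟩ := ih
    obtain ⟨hη, hκ⟩ := isShiftSymbol_η_κ (k := k) n
    refine ⟨2 * M + 4, .of_hasDerivAt ?_ hasDerivAt_cutoff ?_⟩
    · obtain ⟨C, hC⟩ := IsSymbol.exists_bound (γ := shift) (ρ := fun _ => 1) (n := 0) hb (hw 4)
      refine ⟨C, fun x => (hC.2 x).trans ?_⟩
      have := pow_le_pow_right₀ x.one_le_W (show 4 ≤ 2 * M + 4 by omega)
      have := hC.1
      gcongr
    · have hκ' : IsShiftSymbol n (fun _ => 1)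
          (fun x : PhasePoint k => x.η + -1 * (x.κ * (x.κ * x.η))) := by
        refine hη.add (IsShiftSymbol.const_mul one ?_ _)
        have h := hκ.mul one (by simp) (hκ.mul one one hη)
        exact h.congr_weight fun x => by norm_num
      have h := ((isShiftSymbol_ψ n).mul hs (fun x => mul_nonneg (hs x) zero_le_one)
        ((isShiftSymbol_x0 n).mul hs one hκ')).mul
        (fun x => mul_nonneg (hs x) (mul_nonneg (hs x) zero_le_one))
        (fun x => mul_nonneg (hw M x) (hw M x)) (hM.mul (hw M) (hw M) hM)
      refine IsShiftSymbol.const_mul (hw _)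
        (IsSymbol.mono h (fun _ => zero_le_one) (fun x => ?_) (K := 1) fun x => ?_) _
      · exact mul_nonneg (mul_nonneg (hs x) (mul_nonneg (hs x) zero_le_one))
          (mul_nonneg (hw M x) (hw M x))
      · have hs' := x.1.size_pos
        have hle := pow_le_pow_right₀ x.one_le_W (show 2 * M ≤ 2 * M + 4 by omega)
        calc x.1.size * (x.1.size * 1) *
              (x.W ^ M * (x.1.size ^ 2)⁻¹ * (x.W ^ M * (x.1.size ^ 2)⁻¹))
            = x.W ^ (2 * M) * (x.1.size ^ 2)⁻¹ := by
              rw [two_mul, pow_add]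
              field_simp
          _ ≤ 1 * (x.W ^ (2 * M + 4) * (x.1.size ^ 2)⁻¹) := by
              rw [one_mul]
              gcongr

end PhasePoint

end Spacelike

section NonStationaryPhase

namespace PhasePoint

variable {k : ℝ}

/-- The weight with decay of order `l` in the parameter and of order `N` in the momenta. -/
def decay (l N : ℕ) (x : PhasePoint k) : ℝ := (x.1.size ^ l)⁻¹ * (x.W ^ N)⁻¹

lemma decay_nonneg (l N : ℕ) (x : PhasePoint k) : 0 ≤ decay l N x := by
  have := x.1.size_pos
  have := x.W_pos
  rw [decay]
  positivity

/-- Amplitudes of order `-l` in the parameter, rapidly decreasing in the momenta. -/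
structure IsAmplitude (l : ℕ) (a : PhasePoint k → ℂ) : Prop where
  symbol : ∀ n N, IsShiftSymbol n (decay l N) a
  measurable : ∀ b : PhaseParam k, Measurable fun z => a (b, z)

/-- The phase. -/
def phase (x : PhasePoint k) : ℝ :=
  (bracket x.2.1 + bracket x.2.2) * x.1.x0 -
    (⟪x.2.1, x.1.ρ • x.1.e⟫_ℝ + ⟪x.2.2, x.1.ρ • x.1.e⟫_ℝ)

/-- The oscillating factor. -/
def osc (x : PhasePoint k) : ℂ := cexp (-I * (x.phase : ℂ))

lemma norm_osc (x : PhasePoint k) : ‖x.osc‖ = 1 := by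
  rw [osc, show -I * (x.phase : ℂ) = ((-x.phase : ℝ) : ℂ) * I by push_cast; ring]
  exact Complex.norm_exp_ofReal_mul_I _

lemma measurable_osc (b : PhaseParam k) : Measurable fun z => osc (b, z) := by
  have := continuous_bracket
  refine Continuous.measurable ?_
  unfold osc phase
  fun_prop

lemma hasDerivAt_phase (x : PhasePoint k) : HasDerivAt (fun t => (x.shift t).phase) x.ψ 0 := by
  have h1 : (fun t => (x.shift t).phase) = fun t => bracket (x.shift t).2.1 * x.1.x0 +
      (t * -x.1.ρ + (bracket x.2.2 * x.1.x0 -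
        (⟪x.2.1, x.1.ρ • x.1.e⟫_ℝ + ⟪x.2.2, x.1.ρ • x.1.e⟫_ℝ))) := by
    ext t
    have : (x.shift t).1 = x.1 := rfl
    simp only [phase, shift_q, this]
    rw [show ⟪(x.shift t).2.1, x.1.ρ • x.1.e⟫_ℝ = ⟪x.2.1, x.1.ρ • x.1.e⟫_ℝ + t * x.1.ρ by
      simp only [shift_p, inner_add_left, real_inner_smul_left, real_inner_smul_right,
        real_inner_self_eq_norm_sq, x.1.norm_e]
      ring]
    ring
  rw [h1]
  refine ((x.hasDerivAt_bracket.mul_const x.1.x0).add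
    (((hasDerivAt_id (0 : ℝ)).mul_const (-x.1.ρ)).add_const _)).congr_deriv ?_
  rw [ψ]
  ring

lemma hasDerivAt_osc (x : PhasePoint k) :
    HasDerivAt (fun t => (x.shift t).osc) (-I * x.ψ * x.osc) 0 := by
  have h := ((x.hasDerivAt_phase.ofReal_comp).const_mul (-I)).cexp
  refine h.congr_deriv ?_
  rw [shift_zero, osc]
  ring

lemma measurable_flowDeriv {f : PhasePoint k → ℂ} (b : PhaseParam k)
    (hf : Measurable fun z => f (b, z))
    (hd : ∀ x, HasDerivAt (fun t => f (shift x t)) (flowDeriv shift f x) 0) :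
    Measurable fun z => flowDeriv shift f (b, z) := by
  have hu : Filter.Tendsto (fun n : ℕ => (1 / ((n : ℝ) + 1))) Filter.atTop (nhdsWithin 0 {0}ᶜ) :=
    tendsto_nhdsWithin_iff.2 ⟨tendsto_one_div_add_atTop_nhds_zero_nat,
      .of_forall fun n => (Nat.one_div_pos_of_nat (α := ℝ)).ne'⟩
  refine measurable_of_tendsto_metrizable (f := fun (n : ℕ) z =>
    (1 / ((n : ℝ) + 1))⁻¹ • (f (shift (b, z) (1 / ((n : ℝ) + 1))) - f (b, z))) (fun n => ?_) ?_
  · have h := hf.comp (measurable_id.add_const ((1 / ((n : ℝ) + 1)) • (b.e, (0 : V3))))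
    exact (h.sub hf).const_smul (1 / ((n : ℝ) + 1))⁻¹
  · refine tendsto_pi_nhds.2 fun z => ?_
    have h := (hasDerivAt_iff_tendsto_slope_zero.1 (hd (b, z))).comp hu
    simpa only [Function.comp_def, zero_add, shift_zero] using h

lemma integrable_W_inv_pow (b : PhaseParam k) :
    Integrable fun z : V3 × V3 => (W (b, z) ^ 4)⁻¹ := by
  refine (integrable_bracket_pow_inv.mul_prod integrable_bracket_pow_inv).congr
    (.of_forall fun z => ?_)
  simp only [W, mul_pow, mul_inv]

lemma integral_W_inv_pow (b : PhaseParam k) :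
    ∫ z : V3 × V3, (W (b, z) ^ 4)⁻¹ = (∫ p : V3, (bracket p ^ 4)⁻¹) ^ 2 := by
  simp only [W, mul_pow, mul_inv]
  rw [Measure.volume_eq_prod, integral_prod_mul (fun p : V3 => (bracket p ^ 4)⁻¹)
    (fun p : V3 => (bracket p ^ 4)⁻¹), sq]

namespace IsAmplitude

variable {l : ℕ} {a : PhasePoint k → ℂ}

lemma integrable (ha : IsAmplitude l a) (b : PhaseParam k) :
    Integrable fun z => a (b, z) * osc (b, z) := by
  obtain ⟨C, -, hC⟩ := (ha.symbol 0 4).exists_bound (decay_nonneg _ _)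
  refine (((integrable_W_inv_pow b).const_mul (b.size ^ l)⁻¹).const_mul C).mono'
    ((ha.measurable b).mul (measurable_osc b)).aestronglyMeasurable (.of_forall fun z => ?_)
  rw [norm_mul, norm_osc, mul_one]
  exact hC (b, z)

lemma exists_norm_integral_le (ha : IsAmplitude l a) :
    ∃ C, ∀ b : PhaseParam k, ‖∫ z, a (b, z) * osc (b, z)‖ ≤ C * (b.size ^ l)⁻¹ := by
  obtain ⟨C, -, hC⟩ := (ha.symbol 0 4).exists_bound (decay_nonneg _ _)
  refine ⟨C * (∫ p : V3, (bracket p ^ 4)⁻¹) ^ 2, fun b => ?_⟩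
  refine (norm_integral_le_of_norm_le
    (((integrable_W_inv_pow b).const_mul (b.size ^ l)⁻¹).const_mul C)
    (.of_forall fun z => ?_)).trans_eq ?_
  · rw [norm_mul, norm_osc, mul_one]
    exact hC (b, z)
  · rw [integral_const_mul, integral_const_mul, integral_W_inv_pow]
    ring

lemma mul_cutoff (hk : 0 ≤ k) (ha : IsAmplitude l a) :
    IsAmplitude (l + 2) (fun x => a x * (x.cutoff : ℂ)) where
  symbol n N := by
    obtain ⟨M, hM⟩ := exists_isShiftSymbol_cutoff hk n
    have hw : ∀ x : PhasePoint k, 0 ≤ x.W ^ M * (x.1.size ^ 2)⁻¹ := fun x => by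
      have := x.W_pos
      positivity
    refine ((ha.symbol n (N + M)).mul (decay_nonneg _ _) hw hM.ofReal).congr_weight fun x => ?_
    have := x.1.size_pos
    have := x.W_pos
    simp only [decay, pow_add]
    field_simp
  measurable b := by
    refine (ha.measurable b).mul (Complex.measurable_ofReal.comp (Continuous.measurable ?_))
    have h := continuous_bracket
    have h0 : ∀ z : V3 × V3, bracket z.1 ≠ 0 := fun z => (bracket_pos _).ne'
    have h1 : ∀ z : V3 × V3, 1 + (b.x0 * (⟪z.1, b.e⟫_ℝ * (bracket z.1)⁻¹) + -b.ρ) ^ 2 ≠ 0 :=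
      fun z => by positivity
    unfold cutoff ψ κ η
    fun_prop (disch := assumption)

lemma mul_ψ (ha : IsAmplitude (l + 1) a) : IsAmplitude l (fun x => a x * (x.ψ : ℂ)) where
  symbol n N := by
    refine ((ha.symbol n N).mul (decay_nonneg _ _) (fun x => x.1.size_pos.le)
      (isShiftSymbol_ψ n).ofReal).congr_weight fun x => ?_
    have := x.1.size_pos
    have := x.W_pos
    simp only [decay, pow_add]
    field_simp
  measurable b := by
    refine (ha.measurable b).mul (Complex.measurable_ofReal.comp (Continuous.measurable ?_))
    have h := continuous_bracket
    have h0 : ∀ z : V3 × V3, bracket z.1 ≠ 0 := fun z => (bracket_pos _).ne'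
    unfold ψ κ η
    fun_prop (disch := assumption)

lemma hasDerivAt (ha : IsAmplitude l a) (x : PhasePoint k) :
    HasDerivAt (fun t => a (shift x t)) (_root_.flowDeriv shift a x) 0 :=
  IsSymbol.hasDerivAt (ha.symbol 1 0) x

lemma flowDeriv (ha : IsAmplitude l a) : IsAmplitude l (_root_.flowDeriv shift a) where
  symbol n N := (ha.symbol (n + 1) N).flowDeriv.congr_weight fun _ => mul_one _
  measurable b := measurable_flowDeriv b (ha.measurable b) ha.hasDerivAt

lemma of_succ (ha : IsAmplitude (l + 1) a) : IsAmplitude l a where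
  symbol n N := by
    refine (ha.symbol n N).mono (fun _ => zero_le_one) (decay_nonneg _ _) (K := 1) fun x => ?_
    have := x.1.size_pos
    have := x.W_pos
    have := pow_le_pow_right₀ x.1.one_le_size (Nat.le_succ l)
    rw [one_mul, decay, decay]
    gcongr
  measurable := ha.measurable

lemma sub_I_mul (ha : IsAmplitude l a) {c : PhasePoint k → ℂ} (hc : IsAmplitude l c) :
    IsAmplitude l (fun x => a x + -I * c x) where
  symbol n N := (ha.symbol n N).add ((hc.symbol n N).const_mul (decay_nonneg _ _) _)
  measurable b := (ha.measurable b).add ((hc.measurable b).const_mul _)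

/-- One integration by parts gains one order of decay. -/
lemma exists_integral_eq (hk : 0 ≤ k) (ha : IsAmplitude l a) :
    ∃ c : PhasePoint k → ℂ, IsAmplitude (l + 1) c ∧ ∀ b : PhaseParam k,
      ∫ z, a (b, z) * osc (b, z) = ∫ z, c (b, z) * osc (b, z) := by
  have h1 := ha.mul_cutoff hk
  have h2 : IsAmplitude (l + 1) (fun x => a x * (x.cutoff : ℂ) * (x.ψ : ℂ)) := h1.mul_ψ
  have h3 := h2.mul_ψ
  refine ⟨_, h1.of_succ.sub_I_mul h2.flowDeriv, fun b => ?_⟩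
  have : (volume : Measure (V3 × V3)).IsAddHaarMeasure := by
    rw [Measure.volume_eq_prod]
    infer_instance
  have ibp := integral_bilinear_hasLineDerivAt_right_eq_neg_left_of_integrable
    (μ := (volume : Measure (V3 × V3)))
    (B := ContinuousLinearMap.mul ℝ ℂ) (v := (b.e, (0 : V3)))
    (f := fun z => a (b, z) * (cutoff (b, z) : ℂ) * (ψ (b, z) : ℂ)) (g := fun z => osc (b, z))
    (f' := fun z => _root_.flowDeriv shift
      (fun x : PhasePoint k => a x * (x.cutoff : ℂ) * (x.ψ : ℂ)) (b, z))
    (g' := fun z => -I * (ψ (b, z) : ℂ) * osc (b, z))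
    (h2.flowDeriv.integrable b)
    (((h3.integrable b).const_mul (-I)).congr (.of_forall fun z => by
      simp only [ContinuousLinearMap.mul_apply']
      ring))
    (h2.integrable b) (fun z _ => h2.hasDerivAt (b, z)) (fun z _ => hasDerivAt_osc (b, z))
  simp only [ContinuousLinearMap.mul_apply'] at ibp
  have hsplit : ∀ z, a (b, z) * osc (b, z) = a (b, z) * (cutoff (b, z) : ℂ) * osc (b, z) +
      I * (a (b, z) * (cutoff (b, z) : ℂ) * (ψ (b, z) : ℂ) *
        (-I * (ψ (b, z) : ℂ) * osc (b, z))) := by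
    intro z
    have hc : (cutoff (b, z) : ℂ) * (1 + (ψ (b, z) : ℂ) ^ 2) = 1 := by
      have h0 : 1 + ψ (b, z) ^ 2 ≠ 0 := by positivity
      have : cutoff (b, z) * (1 + ψ (b, z) ^ 2) = 1 := inv_mul_cancel₀ h0
      exact_mod_cast this
    linear_combination -(a (b, z) * osc (b, z)) * hc +
      a (b, z) * (cutoff (b, z) : ℂ) * (ψ (b, z) : ℂ) ^ 2 * osc (b, z) * I_sq
  have hInt : Integrable fun z => I * (a (b, z) * (cutoff (b, z) : ℂ) * (ψ (b, z) : ℂ) *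
        (-I * (ψ (b, z) : ℂ) * osc (b, z))) :=
    (h3.integrable b).congr (.of_forall fun z => by
      simp only
      linear_combination a (b, z) * (cutoff (b, z) : ℂ) * (ψ (b, z) : ℂ) ^ 2 * osc (b, z) * I_sq)
  simp only [hsplit, add_mul]
  rw [integral_add (h1.integrable b) hInt, integral_const_mul, ibp,
    integral_add (h1.integrable b) ?_]
  · simp only [mul_assoc (-I)]
    rw [integral_const_mul]
    ring
  · simp only [mul_assoc (-I)]
    exact (h2.flowDeriv.integrable b).const_mul _

lemma exists_norm_integral_le_of_nat (hk : 0 ≤ k) (ha : IsAmplitude l a) (N : ℕ) :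
    ∃ C, ∀ b : PhaseParam k, ‖∫ z, a (b, z) * osc (b, z)‖ ≤ C * (b.size ^ (l + N))⁻¹ := by
  induction N generalizing l a with
  | zero => exact ha.exists_norm_integral_le
  | succ N ih =>
    obtain ⟨c, hc, h⟩ := ha.exists_integral_eq hk
    obtain ⟨C, hC⟩ := ih hc
    refine ⟨C, fun b => ?_⟩
    rw [h b, add_comm N 1, ← add_assoc]
    exact hC b

end IsAmplitude

lemma isShiftSymbol_schwartz (g : SchwartzMap (V3 × V3) ℂ) (n N : ℕ) :
    IsShiftSymbol n (fun x => (x.W ^ N)⁻¹) (fun x : PhasePoint k => g x.2) := by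
  have hg : ∀ g : SchwartzMap (V3 × V3) ℂ,
      ∃ C, ∀ x : PhasePoint k, ‖g x.2‖ ≤ C * (x.W ^ N)⁻¹ := fun g => by
    obtain ⟨C, hC⟩ := g.exists_norm_le_bracket N
    exact ⟨C, fun x => hC _ _⟩
  have hW : ∀ x : PhasePoint k, 0 ≤ (x.W ^ N)⁻¹ := fun x => inv_nonneg.2 (pow_nonneg x.W_pos.le _)
  induction n generalizing g with
  | zero => exact hg g
  | succ n ih =>
    refine IsShiftSymbol.of_hasDerivAt (hg g) (f' := fun x => fderiv ℝ g x.2 (x.1.e, (0 : V3)))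
      (fun x => ?_) ?_
    · exact (g.differentiableAt (x := x.2)).hasFDerivAt.hasLineDerivAt (x.1.e, (0 : V3))
    · simp only [SchwartzMap.fderiv_prod_apply]
      refine IsSymbol.sum _ (fun _ => zero_le_one) hW fun j _ => ?_
      have he : IsShiftSymbol n (fun _ => 1) (fun x : PhasePoint k => (x.1.e j : ℂ)) :=
        IsSymbol.of_invariant (fun _ _ => rfl) (fun _ => zero_le_one) (fun _ => zero_le_one)
          ⟨1, fun x => by
            rw [Complex.norm_real, Real.norm_eq_abs, one_mul, ← x.1.norm_e]
            exact RayPoint.abs_apply_le _ _⟩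
      refine ((he.mul (fun _ => zero_le_one) hW
        (ih (LineDeriv.lineDerivOp (EuclideanSpace.single j (1 : ℝ), (0 : V3)) g))).congr_weight
        fun x => one_mul _).congr fun x => ?_
      simp

lemma isAmplitude_schwartz (g : SchwartzMap (V3 × V3) ℂ) :
    IsAmplitude 0 (fun x : PhasePoint k =>
      g x.2 * ((x.η : ℂ) * (((bracket x.2.2)⁻¹ : ℝ) : ℂ))) where
  symbol n N := by
    have hW : ∀ x : PhasePoint k, 0 ≤ (x.W ^ N)⁻¹ := fun x =>
      inv_nonneg.2 (pow_nonneg x.W_pos.le _)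
    have hq : IsShiftSymbol n (fun _ => 1)
        (fun x : PhasePoint k => (((bracket x.2.2)⁻¹ : ℝ) : ℂ)) :=
      IsSymbol.of_invariant (fun x t => by rw [shift_q]) (fun _ => zero_le_one)
        (fun _ => zero_le_one) ⟨1, fun x => by
          rw [Complex.norm_real, Real.norm_of_nonneg (inv_nonneg.2 (bracket_pos _).le), one_mul]
          exact inv_le_one_of_one_le₀ (one_le_bracket _)⟩
    have hηq := IsShiftSymbol.mul (fun _ => zero_le_one) (fun _ => zero_le_one)
      (isShiftSymbol_η_κ n).1.ofReal hq
    refine (IsShiftSymbol.mul hW (by simp) (isShiftSymbol_schwartz g n N) hηq).congr_weight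
      fun x => ?_
    simp [decay]
  measurable b := by
    have h := continuous_bracket
    have h1 := g.continuous
    have h0 : ∀ z : V3 × V3, bracket z.1 ≠ 0 := fun z => (bracket_pos _).ne'
    have h0' : ∀ z : V3 × V3, bracket z.2 ≠ 0 := fun z => (bracket_pos _).ne'
    refine Continuous.measurable ?_
    unfold η
    fun_prop (disch := assumption)

end PhasePoint

end NonStationaryPhase

/-! ### Rapid decay in the complement of the timelike region -/

section SpacelikeDecay

lemma integral_eq_integral_smul {m : ℝ} (hm : 0 < m) (G : V3 → ℂ) :
    ∫ p, G p = ∫ p, (m ^ 3 : ℂ) * G (m • p) := by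
  have h : |(m ^ Module.finrank ℝ V3)⁻¹| = (m ^ 3)⁻¹ := by
    rw [abs_of_pos (by positivity)]
    simp
  have hm' : (m : ℂ) ≠ 0 := by exact_mod_cast hm.ne'
  rw [integral_const_mul, Measure.integral_comp_smul, h, Complex.real_smul]
  push_cast
  rw [mul_inv_cancel_left₀ (pow_ne_zero 3 hm')]

lemma Iplus_eq_integral_osc {m k : ℝ} (hm : 0 < m) {f g : SchwartzMap (V3 × V3) ℂ}
    (hg : ∀ p q, g (p, q) = f (m • p, m • q)) {x0 : ℝ} {xv : V3} (b : PhaseParam k)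
    (hb0 : b.x0 = m * x0) (hbv : b.ρ • b.e = m • xv) :
    Iplus m f x0 xv = ((((2 * π) ^ 3)⁻¹ * m ^ 6 : ℝ) : ℂ) * ∫ z : V3 × V3,
      g z * ((PhasePoint.η (b, z) : ℂ) * (((bracket z.2)⁻¹ : ℝ) : ℂ)) * PhasePoint.osc (b, z) := by
  have hInt := (PhasePoint.isAmplitude_schwartz g).integrable b
  rw [Measure.volume_eq_prod] at hInt
  rw [Iplus, Complex.ofReal_mul, mul_assoc, Measure.volume_eq_prod, integral_prod _ hInt]
  congr 1
  rw [integral_eq_integral_smul hm, ← integral_const_mul]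
  refine integral_congr_ae (.of_forall fun p => ?_)
  beta_reduce
  rw [integral_eq_integral_smul hm, ← integral_const_mul, ← integral_const_mul]
  refine integral_congr_ae (.of_forall fun q => ?_)
  beta_reduce
  have hp := bracket_pos p
  have hq := bracket_pos q
  have hphase : (ωm m (m • p) + ωm m (m • q)) * x0 - (⟪m • p, xv⟫_ℝ + ⟪m • q, xv⟫_ℝ) =
      PhasePoint.phase (b, (p, q)) := by
    rw [PhasePoint.phase, ωm_smul hm, ωm_smul hm]
    simp only [hb0, hbv, real_inner_smul_left, real_inner_smul_right]
    ring
  have hjac : m ^ 2 / (ωm m (m • p) * ωm m (m • q)) = (bracket p)⁻¹ * (bracket q)⁻¹ := by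
    rw [ωm_smul hm, ωm_smul hm]
    field_simp
  rw [hphase, hjac, hg, PhasePoint.osc, PhasePoint.η]
  push_cast
  ring

lemma exists_phaseParam {m : ℝ} (hm : 0 < m) {x0 : ℝ} {xv : V3} (hx : x0 ^ 2 - ‖xv‖ ^ 2 < 1) :
    ∃ b : PhaseParam m, b.x0 = m * x0 ∧ b.ρ • b.e = m • xv ∧ b.ρ = m * ‖xv‖ := by
  obtain ⟨e, he, hxe⟩ : ∃ e : V3, ‖e‖ = 1 ∧ ‖xv‖ • e = xv := by
    by_cases h : xv = 0
    · exact ⟨EuclideanSpace.single 0 1, by simp, by simp [h]⟩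
    · exact ⟨‖xv‖⁻¹ • xv, norm_smul_inv_norm (𝕜 := ℝ) h,
        smul_inv_smul₀ (norm_ne_zero_iff.2 h) xv⟩
  have habs : |x0| ≤ ‖xv‖ + 1 :=
    abs_le_of_sq_le_sq (by nlinarith [norm_nonneg xv]) (by positivity)
  refine ⟨⟨m * x0, m * ‖xv‖, e, he, by positivity, ?_⟩, rfl, ?_, rfl⟩
  · rw [abs_mul, abs_of_pos hm]
    nlinarith
  · simp only [mul_smul, hxe]

theorem Iplus_spacelike {m : ℝ} (hm : 0 < m) (f : SchwartzMap (V3 × V3) ℂ) (N : ℕ) :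
    ∃ C : ℝ, ∀ (x0 : ℝ) (xv : V3), x0 ^ 2 - ‖xv‖ ^ 2 < 1 →
      ‖Iplus m f x0 xv‖ ≤ C * (1 + Real.sqrt (x0 ^ 2 + ‖xv‖ ^ 2)) ^ (-(N : ℝ)) := by
  obtain ⟨g, hg⟩ := exists_schwartz_comp_smul hm f
  obtain ⟨C, hC⟩ := (PhasePoint.isAmplitude_schwartz (k := m) g).exists_norm_integral_le_of_nat
    hm.le N
  refine ⟨((2 * π) ^ 3)⁻¹ * m ^ 6 * (|C| * (1 + m⁻¹) ^ N), fun x0 xv hx => ?_⟩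
  obtain ⟨b, hb0, hbv, hbρ⟩ := exists_phaseParam hm hx
  have hsize := b.size_pos
  have hR0 : 0 < 1 + √(x0 ^ 2 + ‖xv‖ ^ 2) := by positivity
  have hR : 1 + √(x0 ^ 2 + ‖xv‖ ^ 2) ≤ (1 + m⁻¹) * b.size := by
    have h1 : √(x0 ^ 2 + ‖xv‖ ^ 2) ≤ |x0| + ‖xv‖ := by
      refine Real.sqrt_le_iff.2 ⟨by positivity, ?_⟩
      nlinarith [sq_abs x0, mul_nonneg (abs_nonneg x0) (norm_nonneg xv)]
    have h2 : (1 + m⁻¹) * b.size = 1 + m⁻¹ + (m + 1) * (|x0| + ‖xv‖) := by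
      rw [PhaseParam.size, hb0, hbρ, abs_mul, abs_of_pos hm]
      field_simp
      ring
    rw [h2]
    nlinarith [inv_pos.2 hm, mul_nonneg hm.le (add_nonneg (abs_nonneg x0) (norm_nonneg xv))]
  rw [Iplus_eq_integral_osc hm hg b hb0 hbv, norm_mul, Complex.norm_real,
    Real.norm_of_nonneg (by positivity), Real.rpow_neg hR0.le, Real.rpow_natCast,
    mul_assoc (_ * _)]
  gcongr
  calc _ ≤ C * (b.size ^ (0 + N))⁻¹ := hC b
    _ ≤ |C| * (b.size ^ N)⁻¹ := by
        rw [zero_add]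
        gcongr
        exact le_abs_self C
    _ = |C| * (1 + m⁻¹) ^ N * (((1 + m⁻¹) * b.size) ^ N)⁻¹ := by
        rw [mul_pow]
        field_simp
    _ ≤ _ := by gcongr

end SpacelikeDecay

theorem Iplus_asymptotics (m : ℝ) (hm : 0 < m) (f : SchwartzMap (V3 × V3) ℂ) :
    -- (i) timelike region x·x ≥ 1
    (∃ C : ℝ, ∀ (x0 : ℝ) (xv : V3), 1 ≤ x0 ^ 2 - ‖xv‖ ^ 2 →
      ∀ lam : ℝ, lam = Real.sign x0 * Real.sqrt (x0 ^ 2 - ‖xv‖ ^ 2) →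
      ∀ uv : V3, uv = lam⁻¹ • xv →
        ‖Iplus m f x0 xv -
          Complex.I * ((Real.sign lam : ℝ) : ℂ) *
            Complex.exp (-Complex.I * ((2 * m * lam : ℝ) : ℂ)) *
            (((m / |lam|) ^ 3 : ℝ) : ℂ) * f (m • uv, m • uv)‖ ≤
          C * (1 + Real.sqrt (x0 ^ 2 + ‖xv‖ ^ 2)) ^ (-(4 : ℝ))) ∧
    -- (ii) complement x·x < 1
    (∀ N : ℕ, ∃ C : ℝ, ∀ (x0 : ℝ) (xv : V3), x0 ^ 2 - ‖xv‖ ^ 2 < 1 →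
      ‖Iplus m f x0 xv‖ ≤ C * (1 + Real.sqrt (x0 ^ 2 + ‖xv‖ ^ 2)) ^ (-(N : ℝ))) :=
  ⟨Iplus_timelike hm f, Iplus_spacelike hm f⟩

end
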